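/- arXiv:2302.05273 — 2 statements merged into one kernel-verified Lean document; each statement's English description precedes it below -/
import Mathlib

section
/- Fix an even φ ∈ C_c^∞(ℝ), 0 ≤ φ ≤ 1, with φ(x) = 1 for |x| ≤ 1 and φ(x) = 0 for |x| ≥ 2, and define ψ, φ_k, the projections P_k, P_{≤k}, P_{>k} and the cutoffs φ_ℓ⁽ⁿ⁾ from φ as in the context; write B_n(f) := ‖⟨ξ⟩² f̂(ξ)‖_{L²_ξ} + max_{0 ≤ ℓ ≤ n} 2^{−ℓ/2} ‖φ_ℓ⁽ⁿ⁾(ξ) ⟨ξ⟩² ∂_ξ f̂(ξ)‖_{L²_ξ}. Then there exists a constant C ≥ 1 (depending only on φ) such that for every integer n ≥ 1, every Schwartz function f, and every t ≥ 0: (i) ‖⟨x⟩⁻¹ e^{it⟨D⟩}∂ₓf‖_{H¹} + ‖⟨x⟩⁻¹ e^{it⟨D⟩}(⟨D⟩−1)f‖_{H¹} ≤ C (n/⟨t⟩) B_n(f); (ii) for every integer k ≤ 0, ‖⟨x⟩⁻¹ e^{it⟨D⟩}∂ₓP_{≤k}f‖_{L²} + ‖⟨x⟩⁻¹ e^{it⟨D⟩}∂ₓP_{>k}f‖_{L²}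 ≤ C (n/⟨t⟩) B_n(f); (iii) for every integer k ≤ 0, ‖⟨x⟩⁻¹ e^{it⟨D⟩}P_k f‖_{L²} + ‖⟨x⟩⁻¹ e^{it⟨D⟩}P_{>k}f‖_{L²} ≤ C (2^{|k|} n/⟨t⟩) B_n(f). Here ‖g‖_{H¹}² = ‖g‖_{L²}² + ‖g'‖_{L²}², (⟨D⟩−1)f is the multiplier with symbol ⟨ξ⟩−1, and ∂ₓ corresponds to the symbol iξ. -/
open MeasureTheory Filter Topology

noncomputable section

/-- The Fourier transform `f̂(ξ) = (2π)^{-1/2} ∫ e^{-ixξ} f(x) dx`. -/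
def FT (f : ℝ → ℂ) (ξ : ℝ) : ℂ :=
  (Real.sqrt (2 * Real.pi) : ℂ)⁻¹ * ∫ x : ℝ, Complex.exp (-(Complex.I * (x : ℂ) * (ξ : ℂ))) * f x

/-- The half Klein–Gordon propagator composed with a Fourier multiplier `m(D)`:
`(e^{it⟨D⟩} m(D) f)(x) = (2π)^{-1/2} ∫ e^{ixξ} e^{it⟨ξ⟩} m(ξ) f̂(ξ) dξ`. -/
def propagatorM (m : ℝ → ℂ) (t : ℝ) (f : ℝ → ℂ) (x : ℝ) : ℂ :=
  (Real.sqrt (2 * Real.pi) : ℂ)⁻¹ *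
    ∫ ξ : ℝ, Complex.exp (Complex.I * ((x * ξ + t * Real.sqrt (1 + ξ ^ 2) : ℝ) : ℂ)) *
      m ξ * FT f ξ

/-- The inverse Japanese bracket weight `⟨x⟩⁻¹`. -/
def jbInv (x : ℝ) : ℝ := (Real.sqrt (1 + x ^ 2))⁻¹

/-- The `L²` norm `(∫ ‖g‖²)^{1/2}`. -/
def l2Norm (g : ℝ → ℂ) : ℝ := (∫ x : ℝ, ‖g x‖ ^ 2) ^ ((1 : ℝ) / 2)

/-- The `H¹` norm `(‖g‖_{L²}² + ‖g'‖_{L²}²)^{1/2}`. -/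
def h1Norm (g : ℝ → ℂ) : ℝ := Real.sqrt ((∫ x : ℝ, ‖g x‖ ^ 2) + ∫ x : ℝ, ‖deriv g x‖ ^ 2)

/-- The cutoffs `φ_ℓ⁽ⁿ⁾` adapted to the problematic frequencies `±√3`. -/
def cutoff (φ : ℝ → ℝ) (n ℓ : ℕ) (ξ : ℝ) : ℝ :=
  if ℓ = 0 then 1 - φ (2 ^ 101 * (|ξ| - Real.sqrt 3))
  else if ℓ = n then φ (2 ^ (n + 100) * (|ξ| - Real.sqrt 3))
  else φ (2 ^ (ℓ + 100) * (|ξ| - Real.sqrt 3)) - φ (2 ^ (ℓ + 101) * (|ξ| - Real.sqrt 3))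

/-- The adapted weighted norm `B_n(f)`. -/
def Bn (φ : ℝ → ℝ) (n : ℕ) (f : ℝ → ℂ) : ℝ :=
  (∫ ξ : ℝ, ‖((1 + ξ ^ 2 : ℝ) : ℂ) * FT f ξ‖ ^ 2) ^ ((1 : ℝ) / 2) +
    ⨆ ℓ : Fin (n + 1),
      (2 : ℝ) ^ (-(((ℓ : ℕ) : ℝ)) / 2) *
        (∫ ξ : ℝ, ‖(cutoff φ n (ℓ : ℕ) ξ : ℂ) * ((1 + ξ ^ 2 : ℝ) : ℂ) *
            deriv (FT f) ξ‖ ^ 2) ^ ((1 : ℝ) / 2)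

/-! ### Plancherel on `L¹ ∩ L²` -/

open FourierTransform SchwartzMap in
lemma fourier_ae_eq_Lp (g : ℝ → ℂ) (h1 : Integrable g) (h2 : MemLp g 2 volume) :
    (𝓕 g : ℝ → ℂ) =ᵐ[volume] ((𝓕 (h2.toLp g) : Lp ℂ 2 (volume : Measure ℝ)) : ℝ → ℂ) := by
  have hcont : Continuous (𝓕 g : ℝ → ℂ) :=
    VectorFourier.fourierIntegral_continuous Real.continuous_fourierChar
      (by exact continuous_inner) h1
  apply ae_eq_of_integral_contDiff_smul_eq hcont.locallyIntegrable
    ((Lp.memLp _).locallyIntegrable (by norm_num))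
  intro h hh hs
  have hs' : HasCompactSupport (fun x => (h x : ℂ)) := hs.comp_left (g := fun r : ℝ => (r : ℂ)) (by simp)
  set H : 𝓢(ℝ, ℂ) := hs'.toSchwartzMap (Complex.ofRealCLM.contDiff.comp hh) with hH
  have hHa : ∀ x, H x = (h x : ℂ) := fun x => rfl
  have e1 := Lp.toTemperedDistribution_apply (𝓕 (h2.toLp g) : Lp ℂ 2 (volume : Measure ℝ)) H
  rw [← Lp.fourier_toTemperedDistribution_eq, TemperedDistribution.fourier_apply,
    Lp.toTemperedDistribution_apply] at e1
  have e2 : ∫ x, h x • (𝓕 g : ℝ → ℂ) x = ∫ x, H x • (𝓕 g : ℝ → ℂ) x := by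
    apply integral_congr_ae
    filter_upwards with x
    rw [hHa]; simp
  have e3 : ∫ x, h x • ((𝓕 (h2.toLp g) : Lp ℂ 2 (volume : Measure ℝ)) : ℝ → ℂ) x
      = ∫ x, H x • ((𝓕 (h2.toLp g) : Lp ℂ 2 (volume : Measure ℝ)) : ℝ → ℂ) x := by
    apply integral_congr_ae
    filter_upwards with x
    rw [hHa]; simp
  rw [e2, e3, ← e1]
  have e4 := VectorFourier.integral_fourierIntegral_smul_eq_flip (e := Real.fourierChar)
    (L := innerₗ ℝ) (μ := volume) (ν := volume) (f := H) (g := g)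
    Real.continuous_fourierChar (by exact continuous_inner) H.integrable h1
  have e5 : ∫ x, (𝓕 H : 𝓢(ℝ, ℂ)) x • ((h2.toLp g : Lp ℂ 2 (volume : Measure ℝ)) : ℝ → ℂ) x
      = ∫ x, (𝓕 H : 𝓢(ℝ, ℂ)) x • g x := by
    apply integral_congr_ae
    filter_upwards [h2.coeFn_toLp] with x hx
    rw [hx]
  rw [e5]
  simp only [flip_innerₗ] at e4
  rw [SchwartzMap.fourier_coe]
  exact e4.symm

/-- inverse Fourier transform -/
def IFT (g : ℝ → ℂ) (x : ℝ) : ℂ :=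
  (Real.sqrt (2 * Real.pi) : ℂ)⁻¹ * ∫ ξ : ℝ, Complex.exp (Complex.I * ((x * ξ : ℝ) : ℂ)) * g ξ

lemma l2Norm_eq {g : ℝ → ℂ} (h : MemLp g 2 volume) : l2Norm g = (eLpNorm g 2 volume).toReal := by
  rw [h.eLpNorm_eq_integral_rpow_norm (by norm_num) (by norm_num)]
  rw [ENNReal.toReal_ofReal (by positivity)]
  simp [l2Norm]

lemma l2Norm_nonneg (g : ℝ → ℂ) : 0 ≤ l2Norm g := by
  unfold l2Norm; positivity

lemma l2Norm_sq (g : ℝ → ℂ) : l2Norm g ^ 2 = ∫ x, ‖g x‖ ^ 2 := by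
  unfold l2Norm
  rw [← Real.sqrt_eq_rpow, Real.sq_sqrt (by positivity)]

lemma l2Norm_add_le {f g : ℝ → ℂ} (hf : MemLp f 2 volume) (hg : MemLp g 2 volume) :
    l2Norm (fun x => f x + g x) ≤ l2Norm f + l2Norm g := by
  have : MemLp (fun x => f x + g x) 2 volume := hf.add hg
  rw [l2Norm_eq this, l2Norm_eq hf, l2Norm_eq hg, ← ENNReal.toReal_add hf.eLpNorm_ne_top hg.eLpNorm_ne_top]
  exact ENNReal.toReal_mono (by finiteness [hf.eLpNorm_ne_top, hg.eLpNorm_ne_top])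
    (eLpNorm_add_le hf.1 hg.1 (by norm_num))

lemma l2Norm_mono {f g : ℝ → ℂ} (hg : MemLp g 2 volume) (h : ∀ x, ‖f x‖ ≤ ‖g x‖) :
    l2Norm f ≤ l2Norm g := by
  unfold l2Norm
  have : Integrable (fun x => ‖g x‖ ^ 2) := by
    have := hg.integrable_norm_pow (by norm_num)
    simpa using this
  apply Real.rpow_le_rpow (by positivity) _ (by norm_num)
  apply integral_mono_of_nonneg
  · filter_upwards with x; positivity
  · exact this
  · filter_upwards with x
    have := h x
    gcongr

lemma l2Norm_const_mul (c : ℂ) (g : ℝ → ℂ) : l2Norm (fun x => c * g x) = ‖c‖ * l2Norm g := by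
  unfold l2Norm
  simp only [norm_mul, mul_pow]
  rw [integral_const_mul, Real.mul_rpow (by positivity) (by positivity), ← Real.sqrt_eq_rpow,
    Real.sqrt_sq (by positivity)]

open FourierTransform in
lemma IFT_eq (g : ℝ → ℂ) (x : ℝ) :
    IFT g x = (Real.sqrt (2 * Real.pi) : ℂ)⁻¹ * (𝓕 g : ℝ → ℂ) ((-(2 * Real.pi)⁻¹) * x) := by
  unfold IFT
  rw [Real.fourier_real_eq_integral_exp_smul]
  congr 2
  ext ξ
  rw [smul_eq_mul]
  congr 2
  have : (Real.pi : ℂ) ≠ 0 := by exact_mod_cast Real.pi_ne_zero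
  push_cast
  field_simp

open FourierTransform in
lemma plancherel_IFT {g : ℝ → ℂ} (h1 : Integrable g) (h2 : MemLp g 2 volume) :
    MemLp (IFT g) 2 volume ∧ l2Norm (IFT g) = l2Norm g := by
  have hae := fourier_ae_eq_Lp g h1 h2
  have hF : MemLp (𝓕 g : ℝ → ℂ) 2 volume := (Lp.memLp _).ae_eq hae.symm
  have hFn : l2Norm (𝓕 g : ℝ → ℂ) = l2Norm g := by
    rw [l2Norm_eq hF, l2Norm_eq h2, eLpNorm_congr_ae hae, ← Lp.norm_def, Lp.norm_fourier_eq,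
      Lp.norm_toLp]
  have hcont : Continuous (𝓕 g : ℝ → ℂ) :=
    VectorFourier.fourierIntegral_continuous Real.continuous_fourierChar
      (by exact continuous_inner) h1
  have hIe : IFT g = fun x => (Real.sqrt (2 * Real.pi) : ℂ)⁻¹ * (𝓕 g : ℝ → ℂ) ((-(2 * Real.pi)⁻¹) * x) :=
    funext (IFT_eq g)
  have hpi : (0:ℝ) < 2 * Real.pi := by positivity
  constructor
  · rw [hIe]
    apply MemLp.const_mul
    rw [memLp_two_iff_integrable_sq_norm (by fun_prop)]
    have := (memLp_two_iff_integrable_sq_norm hF.1).1 hF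
    exact this.comp_mul_left' (by simp [Real.pi_ne_zero])
  · have : l2Norm (IFT g) ^ 2 = l2Norm g ^ 2 := by
      rw [← hFn, l2Norm_sq, l2Norm_sq, hIe]
      simp only [norm_mul, mul_pow]
      rw [integral_const_mul, Measure.integral_comp_mul_left (fun y => ‖(𝓕 g : ℝ → ℂ) y‖ ^ 2)]
      rw [norm_inv, Complex.norm_real, Real.norm_eq_abs, inv_pow, sq_abs, Real.sq_sqrt hpi.le,
        inv_neg, inv_inv, abs_neg, abs_of_pos hpi, smul_eq_mul]
      field_simp
    exact (sq_eq_sq₀ (l2Norm_nonneg _) (l2Norm_nonneg _)).1 this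

lemma norm_exp_I_mul (r : ℝ) : ‖Complex.exp (Complex.I * (r : ℂ))‖ = 1 := by
  rw [mul_comm]; exact Complex.norm_exp_ofReal_mul_I r

lemma IFT_norm_le (g : ℝ → ℂ) (x : ℝ) : ‖IFT g x‖ ≤ ∫ ξ, ‖g ξ‖ := by
  unfold IFT
  rw [norm_mul]
  have h1 : ‖(Real.sqrt (2 * Real.pi) : ℂ)⁻¹‖ ≤ 1 := by
    rw [norm_inv, Complex.norm_real, Real.norm_eq_abs, abs_of_nonneg (Real.sqrt_nonneg _)]
    apply inv_le_one_of_one_le₀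
    rw [Real.one_le_sqrt]
    nlinarith [Real.pi_gt_three]
  have h2 : ‖∫ ξ : ℝ, Complex.exp (Complex.I * ((x * ξ : ℝ) : ℂ)) * g ξ‖ ≤ ∫ ξ, ‖g ξ‖ := by
    refine (norm_integral_le_integral_norm _).trans (le_of_eq ?_)
    congr 1
    ext ξ
    rw [norm_mul, norm_exp_I_mul, one_mul]
  calc _ ≤ 1 * ∫ ξ, ‖g ξ‖ := by gcongr
    _ = _ := one_mul _

lemma IFT_continuous {g : ℝ → ℂ} (h1 : Integrable g) : Continuous (IFT g) := by
  rw [show IFT g = _ from funext (IFT_eq g)]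
  have hcont : Continuous (FourierTransform.fourier g : ℝ → ℂ) :=
    VectorFourier.fourierIntegral_continuous Real.continuous_fourierChar
      (by exact continuous_inner) h1
  fun_prop

lemma jb_pos (x : ℝ) : 0 < Real.sqrt (1 + x ^ 2) := Real.sqrt_pos.2 (by positivity)

lemma jbInv_pos (x : ℝ) : 0 < jbInv x := inv_pos.2 (jb_pos x)

lemma one_le_jb (x : ℝ) : 1 ≤ Real.sqrt (1 + x ^ 2) := by
  rw [Real.one_le_sqrt]; nlinarith [sq_nonneg x]

lemma jbInv_le_one (x : ℝ) : jbInv x ≤ 1 := inv_le_one_of_one_le₀ (one_le_jb x)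

lemma abs_le_jb (x : ℝ) : |x| ≤ Real.sqrt (1 + x ^ 2) := Real.abs_le_sqrt (by linarith)

lemma abs_mul_jbInv_le (x : ℝ) : |x| * jbInv x ≤ 1 := by
  unfold jbInv
  rw [← div_eq_mul_inv]
  exact div_le_one_of_le₀ (abs_le_jb x) (jb_pos x).le

lemma jbInv_sq (x : ℝ) : jbInv x ^ 2 = (1 + x ^ 2)⁻¹ := by
  unfold jbInv
  rw [inv_pow, Real.sq_sqrt (by positivity)]

lemma jb_sq (x : ℝ) : Real.sqrt (1 + x ^ 2) ^ 2 = 1 + x ^ 2 := Real.sq_sqrt (by positivity)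

lemma continuous_jbInv : Continuous jbInv := by
  unfold jbInv
  exact Continuous.inv₀ (by fun_prop) (fun x => (jb_pos x).ne')

/-- multiplication by `⟨x⟩⁻¹` of a bounded function -/
lemma l2Norm_jbInv_mul {u : ℝ → ℂ} (hu : Continuous u) {M : ℝ} (hM : ∀ x, ‖u x‖ ≤ M) :
    MemLp (fun x => (jbInv x : ℂ) * u x) 2 volume ∧
    l2Norm (fun x => (jbInv x : ℂ) * u x) ≤ 2 * M := by
  have hM0 : 0 ≤ M := (norm_nonneg _).trans (hM 0)
  have hc : Continuous (fun x => (jbInv x : ℂ)) := Complex.continuous_ofReal.comp continuous_jbInv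
  have hb : ∀ x, ‖(jbInv x : ℂ) * u x‖ ^ 2 ≤ M ^ 2 * (1 + x ^ 2)⁻¹ := by
    intro x
    rw [norm_mul, Complex.norm_real, Real.norm_eq_abs, mul_pow, sq_abs, jbInv_sq, mul_comm]
    have := hM x
    gcongr
  have hi : Integrable (fun x : ℝ => M ^ 2 * (1 + x ^ 2)⁻¹) := integrable_inv_one_add_sq.const_mul _
  constructor
  · rw [memLp_two_iff_integrable_sq_norm (by fun_prop)]
    refine hi.mono' (by fun_prop) ?_
    filter_upwards with x
    rw [Real.norm_of_nonneg (by positivity)]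
    exact hb x
  · apply le_of_sq_le_sq _ (by positivity)
    rw [l2Norm_sq]
    calc _ ≤ ∫ x : ℝ, M ^ 2 * (1 + x ^ 2)⁻¹ := by
          apply integral_mono_of_nonneg
          · filter_upwards with x; positivity
          · exact hi
          · filter_upwards with x using hb x
      _ = M ^ 2 * Real.pi := by rw [integral_const_mul, integral_univ_inv_one_add_sq]
      _ ≤ _ := by nlinarith [Real.pi_le_four, sq_nonneg M]

/-! ### The Fourier transform of a Schwartz function is Schwartz -/

open FourierTransform SchwartzMap in
lemma FT_schwartz (f : SchwartzMap ℝ ℂ) : ∃ F : SchwartzMap ℝ ℂ, FT (⇑f) = ⇑F := by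
  have hpi : (2 * Real.pi)⁻¹ ≠ 0 := by positivity
  let L : ℝ ≃L[ℝ] ℝ := ContinuousLinearEquiv.smulLeft (Units.mk0 ((2 * Real.pi)⁻¹) hpi)
  refine ⟨(Real.sqrt (2 * Real.pi) : ℂ)⁻¹ • SchwartzMap.compCLMOfContinuousLinearEquiv ℂ L (𝓕 f), ?_⟩
  ext ξ
  have hL : L ξ = (2 * Real.pi)⁻¹ * ξ := rfl
  rw [smul_apply, SchwartzMap.compCLMOfContinuousLinearEquiv_apply, smul_eq_mul,
    Function.comp_apply, hL, SchwartzMap.fourier_coe, Real.fourier_real_eq_integral_exp_smul]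
  unfold FT
  congr 2
  ext x
  rw [smul_eq_mul]
  congr 2
  have : (Real.pi : ℂ) ≠ 0 := by exact_mod_cast Real.pi_ne_zero
  push_cast
  field_simp

lemma schwartz_decay (F : SchwartzMap ℝ ℂ) : ∃ K : ℝ, 0 ≤ K ∧ ∀ ξ, (1 + ξ ^ 2) ^ 3 * ‖F ξ‖ ≤ K := by
  refine ⟨2 ^ 6 * ((Finset.Iic ((6, 0) : ℕ × ℕ)).sup fun m => SchwartzMap.seminorm ℝ m.1 m.2) F,
    by positivity, fun ξ => ?_⟩
  have := SchwartzMap.one_add_le_sup_seminorm_apply (𝕜 := ℝ) (m := (6, 0)) (k := 6) (n := 0)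
    le_rfl le_rfl F ξ
  rw [norm_iteratedFDeriv_zero] at this
  refine le_trans ?_ this
  have h2 : (1 + ξ ^ 2) ^ 3 ≤ (1 + ‖ξ‖) ^ 6 := by
    have : 1 + ξ ^ 2 ≤ (1 + ‖ξ‖) ^ 2 := by
      rw [Real.norm_eq_abs]; nlinarith [sq_abs ξ, abs_nonneg ξ]
    calc _ ≤ ((1 + ‖ξ‖) ^ 2) ^ 3 := by gcongr
      _ = _ := by ring
  gcongr

lemma dom_schwartz (F : SchwartzMap ℝ ℂ) {a : ℝ → ℂ} (ha : AEStronglyMeasurable a volume) {K : ℝ}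
    (hK : ∀ ξ, ‖a ξ‖ ≤ K * (1 + ξ ^ 2) ^ 2) :
    Integrable (fun ξ => a ξ * F ξ) ∧ MemLp (fun ξ => a ξ * F ξ) 2 volume := by
  obtain ⟨M, hM0, hM⟩ := schwartz_decay F
  have hK0 : 0 ≤ K := by have := (norm_nonneg _).trans (hK 0); simpa using this
  have hb : ∀ ξ, ‖a ξ * F ξ‖ ≤ K * M * (1 + ξ ^ 2)⁻¹ := by
    intro ξ
    have h1 : (0:ℝ) < 1 + ξ ^ 2 := by positivity
    have h2 : ‖F ξ‖ ≤ M * ((1 + ξ ^ 2) ^ 3)⁻¹ := by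
      rw [← div_eq_mul_inv, le_div_iff₀ (by positivity), mul_comm]; exact hM ξ
    rw [norm_mul]
    calc _ ≤ (K * (1 + ξ ^ 2) ^ 2) * (M * ((1 + ξ ^ 2) ^ 3)⁻¹) :=
          mul_le_mul (hK ξ) h2 (norm_nonneg _) (by positivity)
      _ = _ := by field_simp
  have hm : AEStronglyMeasurable (fun ξ => a ξ * F ξ) volume :=
    ha.mul F.continuous.aestronglyMeasurable
  have h1 : Integrable (fun ξ => a ξ * F ξ) := by
    refine (integrable_inv_one_add_sq.const_mul (K * M)).mono' hm ?_
    filter_upwards with ξ using hb ξ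
  refine ⟨h1, ?_⟩
  rw [memLp_two_iff_integrable_sq_norm hm]
  refine (h1.norm.const_mul (K * M)).mono' (hm.norm.pow 2) ?_
  filter_upwards with ξ
  rw [Real.norm_of_nonneg (by positivity), sq]
  have : ‖a ξ * F ξ‖ ≤ K * M := by
    refine (hb ξ).trans ?_
    have : (1 + ξ ^ 2)⁻¹ ≤ 1 := inv_le_one_of_one_le₀ (by nlinarith [sq_nonneg ξ])
    exact mul_le_of_le_one_right (by positivity) this
  gcongr

/-! ### Consequences of the norm `B_n` -/

lemma Bn_eq (φ : ℝ → ℝ) (n : ℕ) (f : ℝ → ℂ) : Bn φ n f =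
    l2Norm (fun ξ => ((1 + ξ ^ 2 : ℝ) : ℂ) * FT f ξ) + ⨆ ℓ : Fin (n + 1),
      (2 : ℝ) ^ (-(((ℓ : ℕ) : ℝ)) / 2) *
        l2Norm (fun ξ => (cutoff φ n (ℓ : ℕ) ξ : ℂ) * ((1 + ξ ^ 2 : ℝ) : ℂ) * deriv (FT f) ξ) := rfl

lemma cs_l2 {a b : ℝ → ℂ} (ha : MemLp a 2 volume) (hb : MemLp b 2 volume) :
    ∫ x, ‖a x * b x‖ ≤ l2Norm a * l2Norm b := by
  have := integral_mul_norm_le_Lp_mul_Lq (μ := volume) (f := a) (g := b) (p := 2) (q := 2)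
    (by rw [Real.holderConjugate_iff]; norm_num) (by simpa using ha) (by simpa using hb)
  simpa [l2Norm, norm_mul] using this

lemma cutoff_sum (φ : ℝ → ℝ) (n : ℕ) (hn : 1 ≤ n) (ξ : ℝ) :
    1 - cutoff φ n 0 ξ = ∑ ℓ ∈ Finset.Icc 1 n, cutoff φ n ℓ ξ := by
  have key : ∀ m : ℕ, 1 ≤ m → m ≤ n → ∑ ℓ ∈ Finset.Ico 1 m, cutoff φ n ℓ ξ =
      φ (2 ^ 101 * (|ξ| - Real.sqrt 3)) - φ (2 ^ (m + 100) * (|ξ| - Real.sqrt 3)) := by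
    intro m hm
    induction m, hm using Nat.le_induction with
    | base => intro _; simp
    | succ m hm ih =>
      intro h
      rw [Finset.sum_Ico_succ_top hm, ih (by omega)]
      unfold cutoff
      rw [if_neg (by omega), if_neg (by omega)]
      rw [show m + 1 + 100 = m + 101 by ring]
      ring
  rw [← Finset.Ico_insert_right hn, Finset.sum_insert (by simp), key n hn le_rfl]
  unfold cutoff
  rw [if_pos rfl, if_neg (by omega), if_pos rfl]
  ring

section
variable {φ : ℝ → ℝ}

lemma cutoff_cont (hφc : Continuous φ) (n ℓ : ℕ) : Continuous (cutoff φ n ℓ) := by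
  unfold cutoff
  split_ifs <;> fun_prop

lemma cutoff_bd (hφ0 : ∀ x, 0 ≤ φ x) (hφ1 : ∀ x, φ x ≤ 1) (n ℓ : ℕ) (ξ : ℝ) : |cutoff φ n ℓ ξ| ≤ 1 := by
  unfold cutoff
  split_ifs
  · rw [abs_le]; constructor <;> linarith [hφ0 (2 ^ 101 * (|ξ| - Real.sqrt 3)), hφ1 (2 ^ 101 * (|ξ| - Real.sqrt 3))]
  · rw [abs_le]; constructor <;> linarith [hφ0 (2 ^ (n + 100) * (|ξ| - Real.sqrt 3)), hφ1 (2 ^ (n + 100) * (|ξ| - Real.sqrt 3))]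
  · rw [abs_le]; constructor <;> linarith [hφ0 (2 ^ (ℓ + 100) * (|ξ| - Real.sqrt 3)), hφ1 (2 ^ (ℓ + 100) * (|ξ| - Real.sqrt 3)),
      hφ0 (2 ^ (ℓ + 101) * (|ξ| - Real.sqrt 3)), hφ1 (2 ^ (ℓ + 101) * (|ξ| - Real.sqrt 3))]

/-- A set containing the support of the `ℓ`th cutoff. -/
def Sset (ℓ : ℕ) : Set ℝ :=
  Metric.closedBall (Real.sqrt 3) (2 * (2 ^ (ℓ + 100))⁻¹) ∪
    Metric.closedBall (-Real.sqrt 3) (2 * (2 ^ (ℓ + 100))⁻¹)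

lemma cutoff_supp (hφzero : ∀ x : ℝ, 2 ≤ |x| → φ x = 0) (n ℓ : ℕ) (hℓ : 1 ≤ ℓ) (ξ : ℝ) (hξ : ξ ∉ Sset ℓ) : cutoff φ n ℓ ξ = 0 := by
  have hp : (0:ℝ) < 2 ^ (ℓ + 100) := by positivity
  have h1 : 2 ≤ |2 ^ (ℓ + 100) * (|ξ| - Real.sqrt 3)| := by
    by_contra! h
    apply hξ
    rw [abs_mul, abs_of_pos hp, mul_comm, ← lt_div_iff₀ hp, div_eq_mul_inv] at h
    unfold Sset
    rcases le_total 0 ξ with h0 | h0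
    · left
      rw [abs_of_nonneg h0] at h
      rw [Metric.mem_closedBall, Real.dist_eq]; exact h.le
    · right
      rw [abs_of_nonpos h0] at h
      rw [Metric.mem_closedBall, Real.dist_eq, ← abs_neg]
      have e : -(ξ - -Real.sqrt 3) = -ξ - Real.sqrt 3 := by ring
      rw [e]; exact h.le
  have h2 : 2 ≤ |2 ^ (ℓ + 101) * (|ξ| - Real.sqrt 3)| := by
    rw [show ℓ + 101 = (ℓ + 100) + 1 by ring, pow_succ, mul_right_comm, abs_mul, abs_of_pos (by norm_num : (0:ℝ) < 2)]
    linarith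
  unfold cutoff
  rw [if_neg (by omega)]
  split_ifs with h
  · rw [← h]; exact hφzero _ h1
  · rw [hφzero _ h1, hφzero _ h2, sub_zero]

lemma Sset_meas (ℓ : ℕ) : MeasurableSet (Sset ℓ) :=
  (measurableSet_closedBall).union measurableSet_closedBall

lemma Sset_vol (ℓ : ℕ) : volume.real (Sset ℓ) ≤ (2 ^ ℓ)⁻¹ ∧ volume (Sset ℓ) ≠ ⊤ := by
  have hf : volume (Sset ℓ) ≠ ⊤ :=
    (measure_union_lt_top measure_closedBall_lt_top measure_closedBall_lt_top).ne
  refine ⟨?_, hf⟩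
  refine (measureReal_union_le _ _).trans ?_
  simp only [Measure.real, Real.volume_closedBall]
  rw [ENNReal.toReal_ofReal (by positivity), pow_add, mul_inv]
  have : (0:ℝ) ≤ (2 ^ ℓ)⁻¹ := by positivity
  nlinarith [show ((2:ℝ) ^ 100)⁻¹ ≤ 1 / 8 by norm_num]

/-- All the bounds extracted from `B_n(f)`. -/
lemma Bn_bounds (hφc : Continuous φ) (hφ0 : ∀ x, 0 ≤ φ x) (hφ1 : ∀ x, φ x ≤ 1) (hφzero : ∀ x : ℝ, 2 ≤ |x| → φ x = 0) (n : ℕ) (hn : 1 ≤ n) (f : SchwartzMap ℝ ℂ) (F : SchwartzMap ℝ ℂ)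
    (hF : FT (⇑f) = ⇑F) :
    l2Norm (fun ξ => ((1 + ξ ^ 2 : ℝ) : ℂ) * F ξ) ≤ Bn φ n f ∧
    l2Norm (fun ξ => (cutoff φ n 0 ξ : ℂ) * ((1 + ξ ^ 2 : ℝ) : ℂ) * deriv F ξ) ≤ Bn φ n f ∧
    ∫ ξ, ‖((1 - cutoff φ n 0 ξ : ℝ) : ℂ) * ((1 + ξ ^ 2 : ℝ) : ℂ) * deriv F ξ‖ ≤ n * Bn φ n f ∧
    ∀ ξ, ‖F ξ‖ ≤ 3 * n * Bn φ n f := by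
  set D : SchwartzMap ℝ ℂ := SchwartzMap.derivCLM ℂ ℂ F with hD
  have hDa : ∀ ξ, deriv F ξ = D ξ := fun ξ => rfl
  have hcc : ∀ ℓ, Continuous (fun ξ => (cutoff φ n ℓ ξ : ℂ)) :=
    fun ℓ => Complex.continuous_ofReal.comp (cutoff_cont hφc n ℓ)
  set Q : ℕ → ℝ := fun ℓ => l2Norm (fun ξ => (cutoff φ n ℓ ξ : ℂ) * ((1 + ξ ^ 2 : ℝ) : ℂ) * deriv F ξ)
    with hQ
  have hQ0 : ∀ ℓ, 0 ≤ Q ℓ := fun ℓ => l2Norm_nonneg _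
  have hB : Bn φ n f = l2Norm (fun ξ => ((1 + ξ ^ 2 : ℝ) : ℂ) * F ξ) + ⨆ ℓ : Fin (n + 1),
      (2 : ℝ) ^ (-(((ℓ : ℕ) : ℝ)) / 2) * Q ℓ := by rw [Bn_eq, hF]
  have hsup : ∀ ℓ, ℓ ≤ n → (2 : ℝ) ^ (-(ℓ : ℝ) / 2) * Q ℓ ≤ ⨆ ℓ : Fin (n + 1),
      (2 : ℝ) ^ (-(((ℓ : ℕ) : ℝ)) / 2) * Q ℓ := by
    intro ℓ h
    exact le_ciSup (f := fun ℓ : Fin (n + 1) => (2 : ℝ) ^ (-(((ℓ : ℕ) : ℝ)) / 2) * Q ℓ)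
      (Set.finite_range _).bddAbove ⟨ℓ, by omega⟩
  have hsup0 : 0 ≤ ⨆ ℓ : Fin (n + 1), (2 : ℝ) ^ (-(((ℓ : ℕ) : ℝ)) / 2) * Q ℓ :=
    le_trans (mul_nonneg (by positivity) (hQ0 0)) (hsup 0 (by omega))
  have hQB : ∀ ℓ, ℓ ≤ n → (2 : ℝ) ^ (-(ℓ : ℝ) / 2) * Q ℓ ≤ Bn φ n f := by
    intro ℓ h
    rw [hB]
    linarith [hsup ℓ h, l2Norm_nonneg (fun ξ => ((1 + ξ ^ 2 : ℝ) : ℂ) * F ξ)]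
  have ha : l2Norm (fun ξ => ((1 + ξ ^ 2 : ℝ) : ℂ) * F ξ) ≤ Bn φ n f := by rw [hB]; linarith
  have hb : Q 0 ≤ Bn φ n f := by simpa using hQB 0 (by omega)
  have hB0 : 0 ≤ Bn φ n f := (l2Norm_nonneg _).trans ha
  -- integrability
  have hdomc : ∀ ℓ, Integrable (fun ξ => (cutoff φ n ℓ ξ : ℂ) * ((1 + ξ ^ 2 : ℝ) : ℂ) * deriv F ξ) ∧
      MemLp (fun ξ => (cutoff φ n ℓ ξ : ℂ) * ((1 + ξ ^ 2 : ℝ) : ℂ) * deriv F ξ) 2 volume := by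
    intro ℓ
    refine dom_schwartz D (a := fun ξ => (cutoff φ n ℓ ξ : ℂ) * ((1 + ξ ^ 2 : ℝ) : ℂ)) (K := 1)
      (Continuous.aestronglyMeasurable (by have := hcc ℓ; fun_prop)) ?_
    intro ξ
    rw [norm_mul, Complex.norm_real, Complex.norm_real, Real.norm_eq_abs, Real.norm_eq_abs,
      abs_of_pos (by positivity : (0:ℝ) < 1 + ξ ^ 2)]
    nlinarith [cutoff_bd hφ0 hφ1 n ℓ ξ, sq_nonneg ξ, abs_nonneg (cutoff φ n ℓ ξ), sq_nonneg (ξ ^ 2)]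
  -- the pieces near `±√3`
  have hpiece : ∀ ℓ, 1 ≤ ℓ → ℓ ≤ n →
      ∫ ξ, ‖(cutoff φ n ℓ ξ : ℂ) * ((1 + ξ ^ 2 : ℝ) : ℂ) * deriv F ξ‖ ≤ Bn φ n f := by
    intro ℓ h1 h2
    obtain ⟨hv, hvt⟩ := Sset_vol ℓ
    have hI : MemLp ((Sset ℓ).indicator (fun _ => (1 : ℂ))) 2 volume :=
      memLp_indicator_const 2 (Sset_meas ℓ) 1 (Or.inr hvt)
    have hIn : l2Norm ((Sset ℓ).indicator (fun _ => (1 : ℂ))) ≤ (2 : ℝ) ^ (-(ℓ : ℝ) / 2) := by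
      apply le_of_sq_le_sq _ (by positivity)
      rw [l2Norm_sq]
      have : ∀ x, ‖(Sset ℓ).indicator (fun _ => (1 : ℂ)) x‖ ^ 2 = (Sset ℓ).indicator (fun _ => (1 : ℝ)) x := by
        intro x
        by_cases hx : x ∈ Sset ℓ <;> simp [hx]
      simp_rw [this]
      rw [integral_indicator_const _ (Sset_meas ℓ), smul_eq_mul, mul_one]
      refine hv.trans (le_of_eq ?_)
      rw [← Real.rpow_natCast ((2:ℝ) ^ (-(ℓ : ℝ) / 2)), ← Real.rpow_mul (by norm_num),
        ← Real.rpow_natCast 2 ℓ, ← Real.rpow_neg (by norm_num)]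
      congr 1
      push_cast; ring
    have hcs := cs_l2 hI (hdomc ℓ).2
    have he : ∀ ξ, (Sset ℓ).indicator (fun _ => (1 : ℂ)) ξ *
        ((cutoff φ n ℓ ξ : ℂ) * ((1 + ξ ^ 2 : ℝ) : ℂ) * deriv F ξ) =
        (cutoff φ n ℓ ξ : ℂ) * ((1 + ξ ^ 2 : ℝ) : ℂ) * deriv F ξ := by
      intro ξ
      by_cases hx : ξ ∈ Sset ℓ
      · simp [hx]
      · rw [cutoff_supp hφzero n ℓ h1 ξ hx]; simp
    simp_rw [he] at hcs
    refine hcs.trans (le_trans ?_ (hQB ℓ h2))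
    exact mul_le_mul_of_nonneg_right hIn (hQ0 ℓ)
  have hc : ∫ ξ, ‖((1 - cutoff φ n 0 ξ : ℝ) : ℂ) * ((1 + ξ ^ 2 : ℝ) : ℂ) * deriv F ξ‖ ≤ n * Bn φ n f := by
    calc _ ≤ ∫ ξ, ∑ ℓ ∈ Finset.Icc 1 n, ‖(cutoff φ n ℓ ξ : ℂ) * ((1 + ξ ^ 2 : ℝ) : ℂ) * deriv F ξ‖ := by
          apply integral_mono_of_nonneg
          · filter_upwards with ξ; positivity
          · exact integrable_finsetSum _ (fun ℓ _ => (hdomc ℓ).1.norm)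
          · filter_upwards with ξ
            rw [cutoff_sum φ n hn ξ, Complex.ofReal_sum, Finset.sum_mul, Finset.sum_mul]
            exact norm_sum_le _ _
      _ = ∑ ℓ ∈ Finset.Icc 1 n, ∫ ξ, ‖(cutoff φ n ℓ ξ : ℂ) * ((1 + ξ ^ 2 : ℝ) : ℂ) * deriv F ξ‖ :=
          integral_finsetSum _ (fun ℓ _ => (hdomc ℓ).1.norm)
      _ ≤ ∑ ℓ ∈ Finset.Icc 1 n, Bn φ n f := by
          apply Finset.sum_le_sum
          intro ℓ hℓ
          rw [Finset.mem_Icc] at hℓ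
          exact hpiece ℓ hℓ.1 hℓ.2
      _ = _ := by simp
  refine ⟨ha, hb, hc, ?_⟩
  -- away from `±√3`
  have hw := l2Norm_jbInv_mul (u := fun x => (jbInv x : ℂ))
    (Complex.continuous_ofReal.comp continuous_jbInv) (M := 1)
    (fun x => by rw [Complex.norm_real, Real.norm_of_nonneg (jbInv_pos x).le]; exact jbInv_le_one x)
  have hcs := cs_l2 hw.1 (hdomc 0).2
  have he : ∀ ξ, ((jbInv ξ : ℂ) * (jbInv ξ : ℂ)) *
        ((cutoff φ n 0 ξ : ℂ) * ((1 + ξ ^ 2 : ℝ) : ℂ) * deriv F ξ) =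
        (cutoff φ n 0 ξ : ℂ) * deriv F ξ := by
    intro ξ
    have : ((jbInv ξ : ℂ) * (jbInv ξ : ℂ)) * ((1 + ξ ^ 2 : ℝ) : ℂ) = 1 := by
      rw [← Complex.ofReal_mul, ← Complex.ofReal_mul, ← sq, jbInv_sq, inv_mul_cancel₀ (by positivity)]
      simp
    calc _ = (((jbInv ξ : ℂ) * (jbInv ξ : ℂ)) * ((1 + ξ ^ 2 : ℝ) : ℂ)) * ((cutoff φ n 0 ξ : ℂ) * deriv F ξ) := by ring
      _ = _ := by rw [this, one_mul]
  simp_rw [he] at hcs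
  have hout : ∫ ξ, ‖(cutoff φ n 0 ξ : ℂ) * deriv F ξ‖ ≤ 2 * Bn φ n f := by
    refine hcs.trans ?_
    calc _ ≤ (2 * 1) * Bn φ n f := mul_le_mul hw.2 hb (l2Norm_nonneg _) (by norm_num)
      _ = _ := by ring
  have hi0 : Integrable (fun ξ => (cutoff φ n 0 ξ : ℂ) * deriv F ξ) := by
    refine (dom_schwartz D (a := fun ξ => (cutoff φ n 0 ξ : ℂ)) (K := 1)
      (hcc 0).aestronglyMeasurable ?_).1
    intro ξ
    rw [Complex.norm_real, Real.norm_eq_abs]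
    nlinarith [cutoff_bd hφ0 hφ1 n 0 ξ, sq_nonneg ξ, sq_nonneg (ξ ^ 2)]
  have hi1 : Integrable (fun ξ => ((1 - cutoff φ n 0 ξ : ℝ) : ℂ) * ((1 + ξ ^ 2 : ℝ) : ℂ) * deriv F ξ) := by
    refine (dom_schwartz D (a := fun ξ => ((1 - cutoff φ n 0 ξ : ℝ) : ℂ) * ((1 + ξ ^ 2 : ℝ) : ℂ)) (K := 2)
      (Continuous.aestronglyMeasurable ?_) ?_).1
    · have := hcc 0
      push_cast; fun_prop
    intro ξ
    rw [norm_mul, Complex.norm_real, Complex.norm_real, Real.norm_eq_abs, Real.norm_eq_abs,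
      abs_of_pos (by positivity : (0:ℝ) < 1 + ξ ^ 2)]
    have : |1 - cutoff φ n 0 ξ| ≤ 2 := by
      have := abs_le.1 (cutoff_bd hφ0 hφ1 n 0 ξ)
      rw [abs_le]; constructor <;> linarith [this.1, this.2]
    have h3 : 1 + ξ ^ 2 ≤ (1 + ξ ^ 2) ^ 2 := by nlinarith [sq_nonneg ξ, sq_nonneg (ξ ^ 2)]
    exact mul_le_mul this h3 (by positivity) (by norm_num)
  have hDi : Integrable (fun ξ => deriv F ξ) := D.integrable
  have htot : ∫ ξ, ‖deriv F ξ‖ ≤ 3 * n * Bn φ n f := by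
    calc _ ≤ ∫ ξ, (‖(cutoff φ n 0 ξ : ℂ) * deriv F ξ‖ +
          ‖((1 - cutoff φ n 0 ξ : ℝ) : ℂ) * ((1 + ξ ^ 2 : ℝ) : ℂ) * deriv F ξ‖) := by
          apply integral_mono_of_nonneg
          · filter_upwards with ξ; positivity
          · exact hi0.norm.add hi1.norm
          · filter_upwards with ξ
            rw [norm_mul, norm_mul, norm_mul, Complex.norm_real, Complex.norm_real, Complex.norm_real]
            have h1 : (1:ℝ) ≤ ‖1 + ξ ^ 2‖ := by
              rw [Real.norm_of_nonneg (by positivity)]; nlinarith [sq_nonneg ξ]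
            have h2 : (1:ℝ) ≤ ‖cutoff φ n 0 ξ‖ + ‖1 - cutoff φ n 0 ξ‖ := by
              have := norm_add_le (cutoff φ n 0 ξ) (1 - cutoff φ n 0 ξ)
              simpa using this
            have h3 : ‖1 - cutoff φ n 0 ξ‖ ≤ ‖1 - cutoff φ n 0 ξ‖ * ‖1 + ξ ^ 2‖ :=
              le_mul_of_one_le_right (norm_nonneg _) h1
            rw [← add_mul]
            exact le_mul_of_one_le_left (norm_nonneg _) (by linarith)
      _ = _ := integral_add hi0.norm hi1.norm
      _ ≤ 2 * Bn φ n f + n * Bn φ n f := add_le_add hout hc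
      _ ≤ _ := by
          have : (1:ℝ) ≤ n := by exact_mod_cast hn
          nlinarith
  intro ξ
  have htz : Tendsto F atBot (𝓝 0) := F.tendsto_cocompact.mono_left atBot_le_cocompact
  have := integral_Iic_of_hasDerivAt_of_tendsto' (a := ξ) (fun x _ => F.hasDerivAt x)
    hDi.integrableOn htz
  rw [sub_zero] at this
  rw [← this]
  refine (norm_integral_le_integral_norm _).trans (le_trans ?_ htot)
  exact setIntegral_le_integral hDi.norm (by filter_upwards with x; positivity)

end

/-! ### The main weighted estimate -/

/-- the oscillating factor -/
def osc (t ξ : ℝ) : ℂ := Complex.exp (Complex.I * ((t * Real.sqrt (1 + ξ ^ 2) : ℝ) : ℂ))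

lemma osc_norm (t ξ : ℝ) : ‖osc t ξ‖ = 1 := norm_exp_I_mul _

lemma osc_cont (t : ℝ) : Continuous (osc t) := by unfold osc; fun_prop

lemma exp_split (x t ξ : ℝ) :
    Complex.exp (Complex.I * ((x * ξ + t * Real.sqrt (1 + ξ ^ 2) : ℝ) : ℂ)) =
      Complex.exp (Complex.I * ((x * ξ : ℝ) : ℂ)) * osc t ξ := by
  unfold osc
  rw [← Complex.exp_add]; congr 1; push_cast; ring

lemma prop_eq_IFT (m : ℝ → ℂ) (t : ℝ) (f : ℝ → ℂ) :
    propagatorM m t f = IFT (fun ξ => osc t ξ * (m ξ * FT f ξ)) := by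
  ext x
  unfold propagatorM IFT
  congr 2
  ext ξ
  rw [exp_split]; ring

lemma hasDerivAt_jb (ξ : ℝ) :
    HasDerivAt (fun ξ : ℝ => Real.sqrt (1 + ξ ^ 2)) (ξ / Real.sqrt (1 + ξ ^ 2)) ξ := by
  have h1 : HasDerivAt (fun ξ : ℝ => 1 + ξ ^ 2) (2 * ξ) ξ := by
    simpa using ((hasDerivAt_id ξ).pow 2).const_add 1
  have h2 := h1.sqrt (by positivity)
  convert h2 using 1
  field_simp

lemma osc_mul_int {g : ℝ → ℂ} (t : ℝ) (hg : Integrable g) : Integrable (fun ξ => osc t ξ * g ξ) := by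
  refine hg.norm.mono' ((osc_cont t).aestronglyMeasurable.mul hg.1) ?_
  filter_upwards with ξ
  rw [norm_mul, osc_norm, one_mul]

lemma osc_mul_memLp {g : ℝ → ℂ} (t : ℝ) (hg : MemLp g 2 volume) :
    MemLp (fun ξ => osc t ξ * g ξ) 2 volume := by
  refine hg.mono ((osc_cont t).aestronglyMeasurable.mul hg.1) ?_
  filter_upwards with ξ
  rw [norm_mul, osc_norm, one_mul]

lemma osc_mul_l2 (g : ℝ → ℂ) (t : ℝ) : l2Norm (fun ξ => osc t ξ * g ξ) = l2Norm g := by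
  unfold l2Norm
  simp only [norm_mul, osc_norm, one_mul]

lemma exp_mul_int {g : ℝ → ℂ} (x : ℝ) (hg : Integrable g) :
    Integrable (fun ξ : ℝ => Complex.exp (Complex.I * ((x * ξ : ℝ) : ℂ)) * g ξ) := by
  refine hg.norm.mono' (Continuous.aestronglyMeasurable (by fun_prop) |>.mul hg.1) ?_
  filter_upwards with ξ
  rw [norm_mul, norm_exp_I_mul, one_mul]

lemma ibp_identity {b d : ℝ → ℂ} {F : SchwartzMap ℝ ℂ} (hb : ∀ ξ, HasDerivAt b (d ξ) ξ)
    {g2 g3 : ℝ → ℂ}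
    (hg1 : Integrable (fun ξ => b ξ * F ξ)) (hg2 : Integrable g2) (hg3 : Integrable g3)
    (hsum : ∀ ξ, g2 ξ + g3 ξ = d ξ * F ξ + b ξ * deriv F ξ) {m : ℝ → ℂ}
    (hm : ∀ ξ, m ξ = b ξ * ((ξ / Real.sqrt (1 + ξ ^ 2) : ℝ) : ℂ))
    (hmi : Integrable (fun ξ => m ξ * F ξ)) (t x : ℝ) :
    Complex.I * t * IFT (fun ξ => osc t ξ * (m ξ * F ξ)) x =
      -(Complex.I * x * IFT (fun ξ => osc t ξ * (b ξ * F ξ)) x +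
        IFT (fun ξ => osc t ξ * g2 ξ) x + IFT (fun ξ => osc t ξ * g3 ξ) x) := by
  have h1 := exp_mul_int x (osc_mul_int t hg1)
  have h2 := exp_mul_int x (osc_mul_int t hg2)
  have h3 := exp_mul_int x (osc_mul_int t hg3)
  have h4 := exp_mul_int x (osc_mul_int t hmi)
  have hder : ∀ ξ, HasDerivAt
      (fun ξ : ℝ => Complex.exp (Complex.I * ((x * ξ : ℝ) : ℂ)) * (osc t ξ * (b ξ * F ξ)))
      ((Complex.I * t) * (Complex.exp (Complex.I * ((x * ξ : ℝ) : ℂ)) * (osc t ξ * (m ξ * F ξ))) +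
       ((Complex.I * x) * (Complex.exp (Complex.I * ((x * ξ : ℝ) : ℂ)) * (osc t ξ * (b ξ * F ξ))) +
        (Complex.exp (Complex.I * ((x * ξ : ℝ) : ℂ)) * (osc t ξ * g2 ξ) +
        Complex.exp (Complex.I * ((x * ξ : ℝ) : ℂ)) * (osc t ξ * g3 ξ)))) ξ := by
    intro ξ
    have e1 : HasDerivAt (fun ξ : ℝ => Complex.exp (Complex.I * ((x * ξ : ℝ) : ℂ)))
        (Complex.exp (Complex.I * ((x * ξ : ℝ) : ℂ)) * (Complex.I * x)) ξ := by
      have : HasDerivAt (fun ξ : ℝ => ((x * ξ : ℝ) : ℂ)) (x : ℂ) ξ := by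
        have := ((hasDerivAt_id ξ).const_mul x).ofReal_comp
        simpa using this
      exact (this.const_mul Complex.I).cexp
    have e2 : HasDerivAt (osc t) (osc t ξ * (Complex.I * ((t * (ξ / Real.sqrt (1 + ξ ^ 2)) : ℝ) : ℂ))) ξ := by
      have := ((hasDerivAt_jb ξ).const_mul t).ofReal_comp
      exact (this.const_mul Complex.I).cexp
    have e3 := (hb ξ).mul (F.hasDerivAt ξ)
    have e4 := e1.mul (e2.mul e3)
    refine e4.congr_deriv ?_
    simp only [Pi.mul_apply]
    rw [← hsum, hm ξ]
    push_cast
    ring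
  have hz := integral_eq_zero_of_hasDerivAt_of_integrable hder
    ((h4.const_mul _).add ((h1.const_mul _).add (h2.add h3))) h1
  have h23 := h2.fun_add h3
  have h14 := (h1.const_mul (Complex.I * x)).fun_add h23
  rw [integral_add (h4.const_mul _) h14, integral_add (h1.const_mul _) h23, integral_add h2 h3, integral_const_mul,
    integral_const_mul] at hz
  unfold IFT
  linear_combination (Real.sqrt (2 * Real.pi) : ℂ)⁻¹ * hz

lemma norm_one_add_sq (ξ : ℝ) : ‖((1 + ξ ^ 2 : ℝ) : ℂ)‖ = 1 + ξ ^ 2 := by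
  rw [Complex.norm_real, Real.norm_of_nonneg (by positivity)]

lemma one_add_sq_le (ξ : ℝ) : 1 + ξ ^ 2 ≤ (1 + ξ ^ 2) ^ 2 := by
  nlinarith [sq_nonneg ξ, sq_nonneg (ξ ^ 2)]

lemma main_est {φ : ℝ → ℝ} (hφc : Continuous φ) (hφ0 : ∀ x, 0 ≤ φ x) (hφ1 : ∀ x, φ x ≤ 1)
    (hφzero : ∀ x : ℝ, 2 ≤ |x| → φ x = 0) {A : ℝ} {b d1 d2 m : ℝ → ℂ}
    (hb : ∀ ξ, HasDerivAt b (d1 ξ + d2 ξ) ξ)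
    (hd1m : AEStronglyMeasurable d1 volume) (hbA : ∀ ξ, ‖b ξ‖ ≤ A * (1 + ξ ^ 2))
    (hd1A : ∀ ξ, ‖d1 ξ‖ ≤ A * (1 + ξ ^ 2)) (hd2 : Integrable d2) (hd2A : ∫ ξ, ‖d2 ξ‖ ≤ A)
    (hm : ∀ ξ, m ξ = b ξ * ((ξ / Real.sqrt (1 + ξ ^ 2) : ℝ) : ℂ))
    (n : ℕ) (hn : 1 ≤ n) (f : SchwartzMap ℝ ℂ) (t : ℝ) (ht : 0 ≤ t) :
    MemLp (fun x => (jbInv x : ℂ) * propagatorM m t f x) 2 volume ∧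
    l2Norm (fun x => (jbInv x : ℂ) * propagatorM m t f x) ≤
      22 * A * (n / Real.sqrt (1 + t ^ 2)) * Bn φ n f := by
  obtain ⟨F, hF⟩ := FT_schwartz f
  obtain ⟨ha, hb', hc, hd⟩ := Bn_bounds hφc hφ0 hφ1 hφzero n hn f F hF
  set B := Bn φ n f with hB
  have hA0 : 0 ≤ A := (integral_nonneg (fun _ => norm_nonneg _)).trans hd2A
  have hB0 : 0 ≤ B := (l2Norm_nonneg _).trans ha
  have hn1 : (1:ℝ) ≤ n := by exact_mod_cast hn
  have hbc : Continuous b := continuous_iff_continuousAt.2 (fun ξ => (hb ξ).continuousAt)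
  set D : SchwartzMap ℝ ℂ := SchwartzMap.derivCLM ℂ ℂ F with hD
  have hDa : ∀ ξ, deriv F ξ = D ξ := fun ξ => rfl
  have hmc : Continuous m := by
    rw [show m = _ from funext hm]
    refine hbc.mul (Complex.continuous_ofReal.comp ?_)
    exact Continuous.div (by fun_prop) (by fun_prop) (fun x => (jb_pos x).ne')
  have hmb : ∀ ξ, ‖m ξ‖ ≤ ‖b ξ‖ := by
    intro ξ
    rw [hm, norm_mul, Complex.norm_real, Real.norm_eq_abs, abs_div, abs_of_pos (jb_pos ξ)]
    exact mul_le_of_le_one_right (norm_nonneg _) (div_le_one_of_le₀ (abs_le_jb ξ) (jb_pos ξ).le)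
  have up : ∀ ξ r : ℝ, r ≤ A * (1 + ξ ^ 2) → r ≤ A * (1 + ξ ^ 2) ^ 2 := fun ξ r h =>
    h.trans (mul_le_mul_of_nonneg_left (one_add_sq_le ξ) hA0)
  have hχc : Continuous (fun ξ => (cutoff φ n 0 ξ : ℂ)) :=
    Complex.continuous_ofReal.comp (cutoff_cont hφc n 0)
  have hχ : ∀ ξ, ‖(cutoff φ n 0 ξ : ℂ)‖ ≤ 1 := by
    intro ξ
    rw [Complex.norm_real]; exact cutoff_bd hφ0 hφ1 n 0 ξ
  have hχ' : ∀ ξ, ‖((1 - cutoff φ n 0 ξ : ℝ) : ℂ)‖ ≤ 2 := by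
    intro ξ
    have := abs_le.1 (cutoff_bd hφ0 hφ1 n 0 ξ)
    rw [Complex.norm_real, Real.norm_eq_abs, abs_le]; constructor <;> linarith [this.1, this.2]
  -- membership of all pieces
  obtain ⟨hbF1, hbF2⟩ := dom_schwartz F hbc.aestronglyMeasurable (fun ξ => up ξ _ (hbA ξ))
  obtain ⟨hmF1, hmF2⟩ := dom_schwartz F hmc.aestronglyMeasurable
    (fun ξ => up ξ _ ((hmb ξ).trans (hbA ξ)))
  obtain ⟨hdF1, hdF2⟩ := dom_schwartz F hd1m (fun ξ => up ξ _ (hd1A ξ))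
  obtain ⟨hcF1, hcF2⟩ := dom_schwartz D (a := fun ξ => (cutoff φ n 0 ξ : ℂ) * b ξ)
    (hχc.mul hbc).aestronglyMeasurable (K := A) (fun ξ => up ξ _ (by
      rw [norm_mul]
      exact (mul_le_of_le_one_left (norm_nonneg _) (hχ ξ)).trans (hbA ξ)))
  obtain ⟨heF1, -⟩ := dom_schwartz D (a := fun ξ => ((1 - cutoff φ n 0 ξ : ℝ) : ℂ) * b ξ)
    (K := 2 * A) (Continuous.aestronglyMeasurable (by push_cast; fun_prop)) (fun ξ => by
      rw [norm_mul, mul_assoc]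
      exact mul_le_mul (hχ' ξ) (up ξ _ (hbA ξ)) (norm_nonneg _) (by norm_num))
  obtain ⟨-, hwF2⟩ := dom_schwartz F (a := fun ξ => ((1 + ξ ^ 2 : ℝ) : ℂ)) (K := 1)
    (Continuous.aestronglyMeasurable (by fun_prop)) (fun ξ => by
      rw [norm_one_add_sq, one_mul]; exact one_add_sq_le ξ)
  obtain ⟨-, hwD2⟩ := dom_schwartz D (a := fun ξ => (cutoff φ n 0 ξ : ℂ) * ((1 + ξ ^ 2 : ℝ) : ℂ)) (K := 1)
    (Continuous.aestronglyMeasurable (by fun_prop)) (fun ξ => by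
      rw [norm_mul, norm_one_add_sq, one_mul]
      refine le_trans ?_ (one_add_sq_le ξ)
      exact (mul_le_of_le_one_left (by positivity) (hχ ξ)))
  obtain ⟨hwE1, -⟩ := dom_schwartz D
    (a := fun ξ => ((1 - cutoff φ n 0 ξ : ℝ) : ℂ) * ((1 + ξ ^ 2 : ℝ) : ℂ))
    (K := 2) (Continuous.aestronglyMeasurable (by push_cast; fun_prop)) (fun ξ => by
      rw [norm_mul, norm_one_add_sq]
      exact mul_le_mul (hχ' ξ) (one_add_sq_le ξ) (by positivity) (by norm_num))
  have hd2F : Integrable (fun ξ => d2 ξ * F ξ) := by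
    refine (hd2.norm.mul_const (3 * n * B)).mono' (hd2.1.mul F.continuous.aestronglyMeasurable) ?_
    filter_upwards with ξ
    rw [norm_mul]
    exact mul_le_mul_of_nonneg_left (hd ξ) (norm_nonneg _)
  -- `L²` norms of the pieces
  have weight : ∀ a : ℝ → ℂ, (∀ ξ, ‖a ξ‖ ≤ A * (1 + ξ ^ 2)) →
      l2Norm (fun ξ => a ξ * F ξ) ≤ A * B := by
    intro a haA
    calc _ ≤ l2Norm (fun ξ => (A : ℂ) * (((1 + ξ ^ 2 : ℝ) : ℂ) * F ξ)) := by
          apply l2Norm_mono (hwF2.const_mul _)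
          intro ξ
          rw [norm_mul, norm_mul, norm_mul, norm_one_add_sq, Complex.norm_real,
            Real.norm_of_nonneg hA0, ← mul_assoc]
          exact mul_le_mul_of_nonneg_right (haA ξ) (norm_nonneg _)
      _ = A * l2Norm (fun ξ => ((1 + ξ ^ 2 : ℝ) : ℂ) * F ξ) := by
          rw [l2Norm_const_mul, Complex.norm_real, Real.norm_of_nonneg hA0]
      _ ≤ A * B := mul_le_mul_of_nonneg_left ha hA0
  have nb := weight b hbA
  have nm := weight m (fun ξ => (hmb ξ).trans (hbA ξ))
  have nd := weight d1 hd1A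
  have nc : l2Norm (fun ξ => (cutoff φ n 0 ξ : ℂ) * b ξ * D ξ) ≤ A * B := by
    calc _ ≤ l2Norm (fun ξ => (A : ℂ) * ((cutoff φ n 0 ξ : ℂ) * ((1 + ξ ^ 2 : ℝ) : ℂ) * D ξ)) := by
          apply l2Norm_mono (hwD2.const_mul _)
          intro ξ
          rw [norm_mul, norm_mul, norm_mul, norm_mul, norm_mul, norm_one_add_sq, Complex.norm_real A,
            Real.norm_of_nonneg hA0]
          calc _ ≤ ‖(cutoff φ n 0 ξ : ℂ)‖ * (A * (1 + ξ ^ 2)) * ‖D ξ‖ := by gcongr; exact hbA ξ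
            _ = _ := by ring
      _ = A * l2Norm (fun ξ => (cutoff φ n 0 ξ : ℂ) * ((1 + ξ ^ 2 : ℝ) : ℂ) * D ξ) := by
          rw [l2Norm_const_mul, Complex.norm_real, Real.norm_of_nonneg hA0]
      _ ≤ A * B := mul_le_mul_of_nonneg_left hb' hA0
  -- propagator
  have hprop : propagatorM m t f = IFT (fun ξ => osc t ξ * (m ξ * F ξ)) := by
    rw [prop_eq_IFT, hF]
  rw [hprop]
  have hjc : Continuous (fun x => (jbInv x : ℂ)) := Complex.continuous_ofReal.comp continuous_jbInv
  have hjn : ∀ x, ‖(jbInv x : ℂ)‖ ≤ 1 := by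
    intro x
    rw [Complex.norm_real, Real.norm_of_nonneg (jbInv_pos x).le]; exact jbInv_le_one x
  have hxj : ∀ x : ℝ, ‖Complex.I * x * (jbInv x : ℂ)‖ ≤ 1 := by
    intro x
    rw [norm_mul, norm_mul, Complex.norm_real, Complex.norm_real, Complex.norm_I, one_mul,
      Real.norm_of_nonneg (jbInv_pos x).le]
    exact abs_mul_jbInv_le x
  have contr : ∀ (w u : ℝ → ℂ), Continuous w → (∀ x, ‖w x‖ ≤ 1) → MemLp u 2 volume →
      MemLp (fun x => w x * u x) 2 volume ∧ l2Norm (fun x => w x * u x) ≤ l2Norm u := by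
    intro w u hw hw1 hu
    have : ∀ x, ‖w x * u x‖ ≤ ‖u x‖ := fun x => by
      rw [norm_mul]; exact mul_le_of_le_one_left (norm_nonneg _) (hw1 x)
    exact ⟨hu.mono (hw.aestronglyMeasurable.mul hu.1) (by filter_upwards with x using this x),
      l2Norm_mono hu this⟩
  obtain ⟨pm1, pm2⟩ := plancherel_IFT (osc_mul_int t hmF1) (osc_mul_memLp t hmF2)
  rw [osc_mul_l2] at pm2
  obtain ⟨qm1, qm2⟩ := contr _ _ hjc hjn pm1
  refine ⟨qm1, ?_⟩
  have hst := jb_pos t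
  rcases le_total t 1 with ht1 | ht1
  · -- small times
    have h1 : l2Norm (fun x => (jbInv x : ℂ) * IFT (fun ξ => osc t ξ * (m ξ * F ξ)) x) ≤ A * B := by
      linarith
    refine h1.trans ?_
    have h2 : Real.sqrt (1 + t ^ 2) ≤ 2 := by
      rw [Real.sqrt_le_left (by norm_num)]; nlinarith
    have h3 : 1 ≤ 22 * (n / Real.sqrt (1 + t ^ 2)) := by
      rw [← mul_div_assoc, le_div_iff₀ hst]; linarith
    have : 0 ≤ A * B := by positivity
    nlinarith
  · -- large times
    have ht0 : 0 < t := by linarith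
    set g2 : ℝ → ℂ := fun ξ => d1 ξ * F ξ + (cutoff φ n 0 ξ : ℂ) * b ξ * D ξ with hg2
    set g3 : ℝ → ℂ := fun ξ => d2 ξ * F ξ + ((1 - cutoff φ n 0 ξ : ℝ) : ℂ) * b ξ * D ξ with hg3
    have hg2i : Integrable g2 := hdF1.add hcF1
    have hg2m : MemLp g2 2 volume := hdF2.add hcF2
    have hg3i : Integrable g3 := hd2F.add heF1
    have hid := ibp_identity hb hbF1 hg2i hg3i (fun ξ => by
      simp only [hg2, hg3, hDa]; push_cast; ring) hm hmF1 t
    obtain ⟨p11, p12⟩ := plancherel_IFT (osc_mul_int t hbF1) (osc_mul_memLp t hbF2)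
    rw [osc_mul_l2] at p12
    obtain ⟨p21, p22⟩ := plancherel_IFT (osc_mul_int t hg2i) (osc_mul_memLp t hg2m)
    rw [osc_mul_l2] at p22
    obtain ⟨q11, q12⟩ := contr _ _ (by fun_prop) hxj p11
    obtain ⟨q21, q22⟩ := contr _ _ hjc hjn p21
    have ng2 : l2Norm g2 ≤ 2 * (A * B) := by
      have := l2Norm_add_le hdF2 hcF2
      linarith
    have ng3 : ∫ ξ, ‖g3 ξ‖ ≤ 4 * (n * (A * B)) := by
      calc _ ≤ ∫ ξ, (‖d2 ξ‖ * (3 * n * B) + A *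
            ‖((1 - cutoff φ n 0 ξ : ℝ) : ℂ) * ((1 + ξ ^ 2 : ℝ) : ℂ) * D ξ‖) := by
            apply integral_mono_of_nonneg
            · filter_upwards with ξ; positivity
            · exact (hd2.norm.mul_const _).add (hwE1.norm.const_mul _)
            · filter_upwards with ξ
              refine (norm_add_le _ _).trans (add_le_add ?_ ?_)
              · rw [norm_mul]
                exact mul_le_mul_of_nonneg_left (hd ξ) (norm_nonneg _)
              · rw [norm_mul, norm_mul, norm_mul, norm_mul, norm_one_add_sq]
                calc _ ≤ ‖((1 - cutoff φ n 0 ξ : ℝ) : ℂ)‖ * (A * (1 + ξ ^ 2)) * ‖D ξ‖ := by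
                      gcongr; exact hbA ξ
                  _ = _ := by ring
        _ = (∫ ξ, ‖d2 ξ‖) * (3 * n * B) + A * ∫ ξ,
            ‖((1 - cutoff φ n 0 ξ : ℝ) : ℂ) * ((1 + ξ ^ 2 : ℝ) : ℂ) * D ξ‖ := by
            rw [integral_add (hd2.norm.mul_const _) (hwE1.norm.const_mul _), integral_mul_const,
              integral_const_mul]
        _ ≤ A * (3 * n * B) + A * (n * B) := by
            gcongr
            exact hc
        _ = _ := by ring
    obtain ⟨q31, q32⟩ := l2Norm_jbInv_mul (IFT_continuous (osc_mul_int t hg3i))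
      (M := 4 * (n * (A * B))) (fun x => by
        refine (IFT_norm_le _ x).trans (le_trans (le_of_eq ?_) ng3)
        congr 1; ext ξ; rw [norm_mul, osc_norm, one_mul])
    have hall : l2Norm (fun x => (Complex.I * t) *
        ((jbInv x : ℂ) * IFT (fun ξ => osc t ξ * (m ξ * F ξ)) x)) ≤ 11 * (n * (A * B)) := by
      have heq : ∀ x, ‖(Complex.I * t) * ((jbInv x : ℂ) * IFT (fun ξ => osc t ξ * (m ξ * F ξ)) x)‖ =
          ‖(Complex.I * x * (jbInv x : ℂ) * IFT (fun ξ => osc t ξ * (b ξ * F ξ)) x +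
            (jbInv x : ℂ) * IFT (fun ξ => osc t ξ * g2 ξ) x) +
            (jbInv x : ℂ) * IFT (fun ξ => osc t ξ * g3 ξ) x‖ := by
        intro x
        rw [← norm_neg]
        congr 1
        linear_combination (-(jbInv x : ℂ)) * hid x
      refine (l2Norm_mono ((q11.add q21).add q31) (fun x => (heq x).le)).trans ?_
      have l1 := l2Norm_add_le (q11.add q21) q31
      have l2 := l2Norm_add_le q11 q21
      have l3 : A * B ≤ n * (A * B) := le_mul_of_one_le_left (by positivity) hn1
      simp only [Pi.add_apply] at l1
      refine l1.trans ?_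
      have l4 : l2Norm ((fun x : ℝ => Complex.I * x * (jbInv x : ℂ) * IFT (fun ξ => osc t ξ * (b ξ * F ξ)) x) +
        fun x => (jbInv x : ℂ) * IFT (fun ξ => osc t ξ * g2 ξ) x) ≤ A * B + 2 * (A * B) := by
        refine l2.trans ?_
        linarith
      linarith
    rw [l2Norm_const_mul, norm_mul, Complex.norm_I, one_mul, Complex.norm_real,
      Real.norm_of_nonneg ht] at hall
    have h2 : Real.sqrt (1 + t ^ 2) ≤ 2 * t := by
      rw [Real.sqrt_le_left (by linarith)]; nlinarith
    have h5 : 11 * (n * (A * B)) / t ≤ 22 * A * (n / Real.sqrt (1 + t ^ 2)) * B := by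
      rw [show 22 * A * (n / Real.sqrt (1 + t ^ 2)) * B = 22 * (n * (A * B)) / Real.sqrt (1 + t ^ 2) by ring,
        div_le_div_iff₀ ht0 hst]
      have : 0 ≤ n * (A * B) := by positivity
      nlinarith
    refine le_trans ?_ h5
    rw [le_div_iff₀ ht0, mul_comm]
    exact hall

/-! ### Differentiation in `x` and the `H¹` norm -/

lemma IFT_hasDerivAt {g : ℝ → ℂ} (hg : Integrable g)
    (hg' : Integrable (fun ξ : ℝ => (Complex.I * (ξ : ℂ)) * g ξ)) (x : ℝ) :
    HasDerivAt (IFT g) (IFT (fun ξ : ℝ => (Complex.I * (ξ : ℂ)) * g ξ) x) x := by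
  unfold IFT
  refine HasDerivAt.const_mul _ ?_
  have := hasDerivAt_integral_of_dominated_loc_of_deriv_le (μ := volume) (x₀ := x) (s := Set.univ)
    (F := fun (x : ℝ) (ξ : ℝ) => Complex.exp (Complex.I * ((x * ξ : ℝ) : ℂ)) * g ξ)
    (F' := fun (x : ℝ) (ξ : ℝ) => Complex.exp (Complex.I * ((x * ξ : ℝ) : ℂ)) * ((Complex.I * (ξ : ℂ)) * g ξ))
    (bound := fun ξ : ℝ => ‖(Complex.I * (ξ : ℂ)) * g ξ‖)
    Filter.univ_mem (Filter.Eventually.of_forall fun y => (exp_mul_int y hg).1) (exp_mul_int x hg)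
    (exp_mul_int x hg').1 ?_ hg'.norm ?_
  · exact this.2
  · filter_upwards with ξ
    intro y _
    rw [norm_mul, norm_exp_I_mul, one_mul]
  · filter_upwards with ξ
    intro y _
    have e1 : HasDerivAt (fun y : ℝ => Complex.exp (Complex.I * ((y * ξ : ℝ) : ℂ)))
        (Complex.exp (Complex.I * ((y * ξ : ℝ) : ℂ)) * (Complex.I * ξ)) y := by
      have : HasDerivAt (fun y : ℝ => ((y * ξ : ℝ) : ℂ)) (ξ : ℂ) y := by
        have := ((hasDerivAt_id y).mul_const ξ).ofReal_comp
        simpa using this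
      exact (this.const_mul Complex.I).cexp
    refine (e1.mul_const (g ξ)).congr_deriv ?_
    ring

lemma hasDerivAt_jbInv (x : ℝ) : HasDerivAt jbInv (-(x * jbInv x ^ 2) * jbInv x) x := by
  have := (hasDerivAt_jb x).inv (jb_pos x).ne'
  refine this.congr_deriv ?_
  unfold jbInv
  have := (jb_pos x).ne'
  field_simp

lemma h1_est {m m' : ℝ → ℂ} (hmc : Continuous m) (hmA : ∀ ξ, ‖m ξ‖ ≤ 1 + ξ ^ 2)
    (hm' : ∀ ξ : ℝ, m' ξ = Complex.I * (ξ : ℂ) * m ξ) (f : SchwartzMap ℝ ℂ) (t R R' : ℝ)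
    (h : MemLp (fun x => (jbInv x : ℂ) * propagatorM m t f x) 2 volume ∧
      l2Norm (fun x => (jbInv x : ℂ) * propagatorM m t f x) ≤ R)
    (h' : MemLp (fun x => (jbInv x : ℂ) * propagatorM m' t f x) 2 volume ∧
      l2Norm (fun x => (jbInv x : ℂ) * propagatorM m' t f x) ≤ R') :
    h1Norm (fun x => (jbInv x : ℂ) * propagatorM m t f x) ≤ 2 * R + R' := by
  obtain ⟨F, hF⟩ := FT_schwartz f
  have hmi : Integrable (fun ξ => m ξ * F ξ) :=
    (dom_schwartz F hmc.aestronglyMeasurable (K := 1) (fun ξ => by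
      rw [one_mul]; exact (hmA ξ).trans (one_add_sq_le ξ))).1
  have hmi' : Integrable (fun ξ => m' ξ * F ξ) := by
    refine (dom_schwartz F (a := m') ?_ (K := 1) (fun ξ => ?_)).1
    · rw [show m' = _ from funext hm']
      exact Continuous.aestronglyMeasurable (by fun_prop)
    · rw [hm', norm_mul, norm_mul, Complex.norm_I, Complex.norm_real, one_mul, one_mul, sq]
      refine mul_le_mul ?_ (hmA ξ) (norm_nonneg _) (by positivity)
      rw [Real.norm_eq_abs]
      nlinarith [sq_abs ξ, sq_nonneg (|ξ| - 1)]
  have hu : propagatorM m t f = IFT (fun ξ => osc t ξ * (m ξ * F ξ)) := by rw [prop_eq_IFT, hF]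
  have hfun : (fun ξ : ℝ => (Complex.I * (ξ : ℂ)) * (osc t ξ * (m ξ * F ξ))) =
      fun ξ => osc t ξ * (m' ξ * F ξ) := by
    ext ξ; rw [hm']; ring
  have hu' : propagatorM m' t f = IFT (fun ξ : ℝ => (Complex.I * (ξ : ℂ)) * (osc t ξ * (m ξ * F ξ))) := by
    rw [prop_eq_IFT, hF, hfun]
  have hder : ∀ x, HasDerivAt (propagatorM m t f) (propagatorM m' t f x) x := by
    intro x
    rw [hu, hu']
    exact IFT_hasDerivAt (osc_mul_int t hmi) (by rw [hfun]; exact osc_mul_int t hmi') x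
  have hd : deriv (fun x => (jbInv x : ℂ) * propagatorM m t f x) = fun x =>
      ((-(x * jbInv x ^ 2) : ℝ) : ℂ) * ((jbInv x : ℂ) * propagatorM m t f x) +
        (jbInv x : ℂ) * propagatorM m' t f x := by
    ext x
    have := ((hasDerivAt_jbInv x).ofReal_comp.mul (hder x)).deriv
    refine Eq.trans this ?_
    push_cast; ring
  have hw : ∀ x : ℝ, ‖((-(x * jbInv x ^ 2) : ℝ) : ℂ)‖ ≤ 1 := by
    intro x
    rw [Complex.norm_real, norm_neg, norm_mul, norm_pow, Real.norm_eq_abs,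
      Real.norm_of_nonneg (jbInv_pos x).le, sq, ← mul_assoc]
    exact mul_le_one₀ (abs_mul_jbInv_le x) (jbInv_pos x).le (jbInv_le_one x)
  have hle : ∀ x, ‖((-(x * jbInv x ^ 2) : ℝ) : ℂ) * ((jbInv x : ℂ) * propagatorM m t f x)‖ ≤
      ‖(jbInv x : ℂ) * propagatorM m t f x‖ := fun x => by
    rw [norm_mul]; exact mul_le_of_le_one_left (norm_nonneg _) (hw x)
  have hmem : MemLp (fun x => ((-(x * jbInv x ^ 2) : ℝ) : ℂ) *
      ((jbInv x : ℂ) * propagatorM m t f x)) 2 volume := by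
    refine h.1.mono (AEStronglyMeasurable.mul (Continuous.aestronglyMeasurable ?_) h.1.1)
      (by filter_upwards with x using hle x)
    have := continuous_jbInv
    fun_prop
  have hdn : l2Norm (deriv (fun x => (jbInv x : ℂ) * propagatorM m t f x)) ≤ R + R' := by
    rw [hd]
    have e1 := l2Norm_add_le hmem h'.1
    have e2 := l2Norm_mono h.1 hle
    linarith [h.2, h'.2]
  have hR := h.2
  have e0 := l2Norm_nonneg (fun x => (jbInv x : ℂ) * propagatorM m t f x)
  have e0' := l2Norm_nonneg (deriv (fun x => (jbInv x : ℂ) * propagatorM m t f x))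
  unfold h1Norm
  rw [← l2Norm_sq, ← l2Norm_sq, Real.sqrt_le_left (by linarith)]
  nlinarith

/-! ### Scaled symbols -/

lemma jb_sub_one_le (ξ : ℝ) : |Real.sqrt (1 + ξ ^ 2) - 1| ≤ |ξ| := by
  rw [abs_of_nonneg (by linarith [one_le_jb ξ])]
  have : Real.sqrt (1 + ξ ^ 2) ≤ 1 + |ξ| := by
    rw [Real.sqrt_le_left (by positivity)]; nlinarith [sq_abs ξ, abs_nonneg ξ]
  linarith

lemma jb_le (ξ : ℝ) : Real.sqrt (1 + ξ ^ 2) ≤ 1 + ξ ^ 2 := by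
  rw [Real.sqrt_le_left (by positivity)]; exact one_add_sq_le ξ

lemma abs_div_jb_le (ξ : ℝ) : |ξ / Real.sqrt (1 + ξ ^ 2)| ≤ 1 := by
  rw [abs_div, abs_of_pos (jb_pos ξ)]
  exact div_le_one_of_le₀ (abs_le_jb ξ) (jb_pos ξ).le

lemma cont_div_jb : Continuous (fun ξ : ℝ => ξ / Real.sqrt (1 + ξ ^ 2)) :=
  Continuous.div (by fun_prop) (by fun_prop) (fun x => (jb_pos x).ne')

lemma scaled_est {φ : ℝ → ℝ} (hφc : Continuous φ) (hφ0 : ∀ x, 0 ≤ φ x) (hφ1 : ∀ x, φ x ≤ 1)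
    (hφzero : ∀ x : ℝ, 2 ≤ |x| → φ x = 0) {h : ℝ → ℝ} (hh : Differentiable ℝ h) {K : ℝ}
    (hK : ∀ y, |h y| ≤ K) (hK' : ∀ y, |deriv h y| ≤ K * (1 + y ^ 2)⁻¹) (c : ℂ) {s : ℝ} (hs : 0 < s)
    {m : ℝ → ℂ} (hm : ∀ ξ, m ξ = c * ((ξ * h (s * ξ) : ℝ) : ℂ))
    (n : ℕ) (hn : 1 ≤ n) (f : SchwartzMap ℝ ℂ) (t : ℝ) (ht : 0 ≤ t) :
    MemLp (fun x => (jbInv x : ℂ) * propagatorM m t f x) 2 volume ∧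
    l2Norm (fun x => (jbInv x : ℂ) * propagatorM m t f x) ≤
      22 * (4 * (‖c‖ * K)) * (n / Real.sqrt (1 + t ^ 2)) * Bn φ n f := by
  have hK0 : 0 ≤ K := (abs_nonneg _).trans (hK 0)
  have hcK : 0 ≤ ‖c‖ * K := by positivity
  have hdm : Measurable (deriv h) := measurable_deriv h
  have hdms : Measurable (fun ξ : ℝ => s * deriv h (s * ξ)) :=
    (hdm.comp (measurable_const_mul s)).const_mul s
  have hhc := hh.continuous
  have hInteg : Integrable (fun ξ : ℝ => K * (s * (1 + (s * ξ) ^ 2)⁻¹)) :=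
    ((integrable_inv_one_add_sq.comp_mul_left' hs.ne').const_mul s).const_mul K
  have hptw : ∀ ξ : ℝ, |s * deriv h (s * ξ)| ≤ K * (s * (1 + (s * ξ) ^ 2)⁻¹) := by
    intro ξ
    rw [abs_mul, abs_of_pos hs]
    nlinarith [hK' (s * ξ)]
  refine main_est hφc hφ0 hφ1 hφzero
    (b := fun ξ => c * ((Real.sqrt (1 + ξ ^ 2) * h (s * ξ) : ℝ) : ℂ))
    (d1 := fun ξ => c * ((ξ / Real.sqrt (1 + ξ ^ 2) * h (s * ξ) +
      (Real.sqrt (1 + ξ ^ 2) - 1) * (s * deriv h (s * ξ)) : ℝ) : ℂ))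
    (d2 := fun ξ => c * ((s * deriv h (s * ξ) : ℝ) : ℂ))
    ?_ ?_ ?_ ?_ ?_ ?_ ?_ n hn f t ht
  · intro ξ
    have e1 : HasDerivAt (fun ξ : ℝ => h (s * ξ)) (deriv h (s * ξ) * s) ξ := by
      have := (hh (s * ξ)).hasDerivAt.comp ξ ((hasDerivAt_id ξ).const_mul s)
      exact HasDerivAt.congr_deriv this (by simp)
    have e2 := (((hasDerivAt_jb ξ).mul e1).ofReal_comp).const_mul c
    refine e2.congr_deriv ?_
    push_cast; ring
  · apply Measurable.aestronglyMeasurable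
    apply Measurable.const_mul
    apply Complex.measurable_ofReal.comp
    apply Measurable.add
    · exact (cont_div_jb.mul (by fun_prop)).measurable
    · exact Measurable.mul (Continuous.measurable (by fun_prop)) hdms
  · intro ξ
    rw [norm_mul, Complex.norm_real, Real.norm_eq_abs, abs_mul, abs_of_pos (jb_pos ξ)]
    calc _ ≤ ‖c‖ * ((1 + ξ ^ 2) * K) := by
          gcongr
          · exact jb_le ξ
          · exact hK _
      _ ≤ 4 * (‖c‖ * K) * (1 + ξ ^ 2) := by
          have : 0 ≤ ‖c‖ * K * (1 + ξ ^ 2) := by positivity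
          nlinarith
  · intro ξ
    rw [norm_mul, Complex.norm_real, Real.norm_eq_abs]
    have e1 : |ξ / Real.sqrt (1 + ξ ^ 2) * h (s * ξ)| ≤ K := by
      rw [abs_mul]
      exact (mul_le_of_le_one_left (abs_nonneg _) (abs_div_jb_le ξ)).trans (hK _)
    have e2 : |(Real.sqrt (1 + ξ ^ 2) - 1) * (s * deriv h (s * ξ))| ≤ K := by
      rw [abs_mul]
      calc _ ≤ |ξ| * (K * (s * (1 + (s * ξ) ^ 2)⁻¹)) :=
            mul_le_mul (jb_sub_one_le ξ) (hptw ξ) (abs_nonneg _) (abs_nonneg _)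
        _ = K * ((s * |ξ|) * (1 + (s * ξ) ^ 2)⁻¹) := by ring
        _ ≤ K * 1 := by
            apply mul_le_mul_of_nonneg_left _ hK0
            rw [← div_eq_mul_inv]
            apply div_le_one_of_le₀ _ (by positivity)
            have : (s * ξ) ^ 2 = (s * |ξ|) ^ 2 := by rw [mul_pow, mul_pow, sq_abs]
            rw [this]; nlinarith [sq_nonneg (s * |ξ| - 1)]
        _ = K := mul_one K
    calc _ ≤ ‖c‖ * (K + K) := by
          gcongr
          exact (abs_add_le _ _).trans (add_le_add e1 e2)
      _ ≤ 4 * (‖c‖ * K) * (1 + ξ ^ 2) := by nlinarith [sq_nonneg ξ]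
  · apply Integrable.const_mul
    refine hInteg.mono' (Complex.measurable_ofReal.comp hdms).aestronglyMeasurable ?_
    filter_upwards with ξ
    rw [Complex.norm_real]; exact hptw ξ
  · calc _ ≤ ∫ ξ : ℝ, ‖c‖ * (K * (s * (1 + (s * ξ) ^ 2)⁻¹)) := by
          apply integral_mono_of_nonneg
          · filter_upwards with ξ; positivity
          · exact hInteg.const_mul _
          · filter_upwards with ξ
            rw [norm_mul, Complex.norm_real]
            exact mul_le_mul_of_nonneg_left (hptw ξ) (norm_nonneg _)
      _ = ‖c‖ * K * Real.pi := by
          rw [integral_const_mul, integral_const_mul, integral_const_mul,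
            Measure.integral_comp_mul_left (fun y : ℝ => (1 + y ^ 2)⁻¹), integral_univ_inv_one_add_sq,
            abs_of_pos (inv_pos.2 hs), smul_eq_mul]
          field_simp
      _ ≤ _ := by nlinarith [Real.pi_le_four]
  · intro ξ
    rw [hm, mul_assoc, ← Complex.ofReal_mul]
    congr 2
    have := (jb_pos ξ).ne'
    field_simp

/-- symbols vanishing near zero -/
lemma quotient_bounds {q : ℝ → ℝ} (hq : Differentiable ℝ q) {K : ℝ} (hq1 : ∀ y, |q y| ≤ 1)
    (hq0 : ∀ y, |y| ≤ 1 / 2 → q y = 0) (hqK : ∀ y, |deriv q y| ≤ K * (1 + y ^ 2)⁻¹) :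
    Differentiable ℝ (fun y => q y / y) ∧ (∀ y, |q y / y| ≤ 2 * K + 5) ∧
      ∀ y, |deriv (fun y => q y / y) y| ≤ (2 * K + 5) * (1 + y ^ 2)⁻¹ := by
  have hK0 : 0 ≤ K := by have := (abs_nonneg _).trans (hqK 0); simpa using this
  have hsmall : ∀ y, |y| < 1 / 2 → HasDerivAt (fun y => q y / y) 0 y := by
    intro y hy
    have : (fun y => q y / y) =ᶠ[𝓝 y] fun _ => 0 := by
      filter_upwards [(isOpen_lt continuous_abs continuous_const).mem_nhds hy] with z hz
      rw [hq0 z (le_of_lt hz), zero_div]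
    exact (hasDerivAt_const y (0:ℝ)).congr_of_eventuallyEq this
  have hlarge : ∀ y, 1 / 2 ≤ |y| → HasDerivAt (fun y => q y / y) ((deriv q y * y - q y * 1) / y ^ 2) y := by
    intro y hy
    have hy0 : y ≠ 0 := by rintro rfl; norm_num at hy
    exact (hq y).hasDerivAt.div (hasDerivAt_id y) hy0
  refine ⟨fun y => ?_, fun y => ?_, fun y => ?_⟩
  · rcases lt_or_ge |y| (1 / 2) with hy | hy
    · exact (hsmall y hy).differentiableAt
    · exact (hlarge y hy).differentiableAt
  · rcases lt_or_ge |y| (1 / 2) with hy | hy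
    · rw [hq0 y hy.le]; simp; positivity
    · rw [abs_div, div_le_iff₀ (by linarith)]
      have := hq1 y
      nlinarith
  · rcases lt_or_ge |y| (1 / 2) with hy | hy
    · rw [(hsmall y hy).deriv]; simp; positivity
    · rw [(hlarge y hy).deriv]
      have hyp : 0 < |y| := by linarith
      have hy2 : (0:ℝ) < y ^ 2 := by rw [← sq_abs]; positivity
      have h1 : |deriv q y| * (1 + y ^ 2) ≤ K := by
        have := hqK y
        rwa [← div_eq_mul_inv, le_div_iff₀ (by positivity)] at this
      rw [abs_div, abs_of_pos hy2, ← div_eq_mul_inv, div_le_div_iff₀ hy2 (by positivity)]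
      have h2 : |deriv q y * y - q y * 1| ≤ |deriv q y| * |y| + 1 := by
        refine (abs_sub _ _).trans ?_
        rw [abs_mul, mul_one]
        linarith [hq1 y]
      have h3 : 1 + y ^ 2 ≤ 5 * y ^ 2 := by rw [← sq_abs]; nlinarith
      have h4 : |y| ≤ 2 * y ^ 2 := by rw [← sq_abs]; nlinarith
      calc _ ≤ (|deriv q y| * |y| + 1) * (1 + y ^ 2) := by gcongr
        _ = (|deriv q y| * (1 + y ^ 2)) * |y| + (1 + y ^ 2) := by ring
        _ ≤ K * (2 * y ^ 2) + 5 * y ^ 2 := by gcongr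
        _ = _ := by ring

lemma deriv_phi_bound {φ : ℝ → ℝ} (hφ : ContDiff ℝ (⊤ : ℕ∞) φ)
    (hφzero : ∀ x : ℝ, 2 ≤ |x| → φ x = 0) :
    ∃ K : ℝ, 1 ≤ K ∧ ∀ y, |deriv φ y| ≤ K * (1 + y ^ 2)⁻¹ := by
  have hc : Continuous (deriv φ) := hφ.continuous_deriv (by exact_mod_cast le_top)
  obtain ⟨M, hM⟩ := (isCompact_Icc (a := (-2:ℝ)) (b := 2)).exists_bound_of_continuousOn
    (f := fun y => deriv φ y * (1 + y ^ 2)) (by fun_prop)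
  refine ⟨max 1 M, le_max_left _ _, fun y => ?_⟩
  rw [← div_eq_mul_inv, le_div_iff₀ (by positivity)]
  by_cases hy : y ∈ Set.Icc (-2:ℝ) 2
  · have := hM y hy
    rw [norm_mul, Real.norm_eq_abs, Real.norm_of_nonneg (by positivity)] at this
    exact this.trans (le_max_right _ _)
  · have hy2 : 2 < |y| := by
      by_contra! h
      exact hy (abs_le.1 h)
    have : φ =ᶠ[𝓝 y] fun _ => 0 := by
      filter_upwards [(isOpen_lt continuous_const continuous_abs).mem_nhds hy2] with z hz
      exact hφzero z (le_of_lt hz)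
    rw [this.deriv_eq]; simp

/-! ### The unscaled symbols of part (i) -/

section
variable {φ : ℝ → ℝ}

lemma est_xi_sq (hφc : Continuous φ) (hφ0 : ∀ x, 0 ≤ φ x) (hφ1 : ∀ x, φ x ≤ 1)
    (hφzero : ∀ x : ℝ, 2 ≤ |x| → φ x = 0)
    (n : ℕ) (hn : 1 ≤ n) (f : SchwartzMap ℝ ℂ) (t : ℝ) (ht : 0 ≤ t) :
    MemLp (fun x => (jbInv x : ℂ) * propagatorM (fun ξ => ((-(ξ ^ 2) : ℝ) : ℂ)) t f x) 2 volume ∧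
    l2Norm (fun x => (jbInv x : ℂ) * propagatorM (fun ξ => ((-(ξ ^ 2) : ℝ) : ℂ)) t f x) ≤
      22 * 2 * (n / Real.sqrt (1 + t ^ 2)) * Bn φ n f := by
  refine main_est hφc hφ0 hφ1 hφzero
    (b := fun ξ => ((-(ξ * Real.sqrt (1 + ξ ^ 2)) : ℝ) : ℂ))
    (d1 := fun ξ => ((-(1 * Real.sqrt (1 + ξ ^ 2) + ξ * (ξ / Real.sqrt (1 + ξ ^ 2))) : ℝ) : ℂ))
    (d2 := fun _ => 0) ?_ ?_ ?_ ?_ ?_ ?_ ?_ n hn f t ht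
  · intro ξ
    rw [add_zero]
    exact (((hasDerivAt_id ξ).mul (hasDerivAt_jb ξ)).neg).ofReal_comp
  · have := cont_div_jb
    exact Continuous.aestronglyMeasurable (by fun_prop)
  · intro ξ
    rw [Complex.norm_real, norm_neg, norm_mul, Real.norm_eq_abs, Real.norm_of_nonneg (jb_pos ξ).le]
    nlinarith [abs_le_jb ξ, jb_sq ξ, jb_pos ξ]
  · intro ξ
    rw [Complex.norm_real, norm_neg, Real.norm_eq_abs]
    have e1 : |ξ * (ξ / Real.sqrt (1 + ξ ^ 2))| ≤ Real.sqrt (1 + ξ ^ 2) := by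
      rw [abs_mul]
      exact (mul_le_of_le_one_right (abs_nonneg _) (abs_div_jb_le ξ)).trans (abs_le_jb ξ)
    refine (abs_add_le _ _).trans ?_
    rw [one_mul, abs_of_pos (jb_pos ξ)]
    linarith [jb_le ξ]
  · exact integrable_zero _ _ _
  · simp
  · intro ξ
    rw [← Complex.ofReal_mul]
    congr 1
    have := (jb_pos ξ).ne'
    field_simp

lemma est_jb (hφc : Continuous φ) (hφ0 : ∀ x, 0 ≤ φ x) (hφ1 : ∀ x, φ x ≤ 1)
    (hφzero : ∀ x : ℝ, 2 ≤ |x| → φ x = 0)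
    (n : ℕ) (hn : 1 ≤ n) (f : SchwartzMap ℝ ℂ) (t : ℝ) (ht : 0 ≤ t) :
    MemLp (fun x => (jbInv x : ℂ) *
      propagatorM (fun ξ => ((Real.sqrt (1 + ξ ^ 2) - 1 : ℝ) : ℂ)) t f x) 2 volume ∧
    l2Norm (fun x => (jbInv x : ℂ) *
      propagatorM (fun ξ => ((Real.sqrt (1 + ξ ^ 2) - 1 : ℝ) : ℂ)) t f x) ≤
      22 * 2 * (n / Real.sqrt (1 + t ^ 2)) * Bn φ n f := by
  have hp : ∀ ξ : ℝ, 0 < Real.sqrt (1 + ξ ^ 2) + 1 := fun ξ => by linarith [jb_pos ξ]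
  have hle : ∀ ξ : ℝ, |(Real.sqrt (1 + ξ ^ 2) + 1)⁻¹| ≤ 1 := fun ξ => by
    rw [abs_of_pos (inv_pos.2 (hp ξ))]
    exact inv_le_one_of_one_le₀ (by linarith [jb_pos ξ])
  have hinvc : Continuous (fun ξ : ℝ => (Real.sqrt (1 + ξ ^ 2) + 1)⁻¹) :=
    Continuous.inv₀ (by fun_prop) (fun ξ => (hp ξ).ne')
  refine main_est hφc hφ0 hφ1 hφzero
    (b := fun ξ => ((ξ * (1 - (Real.sqrt (1 + ξ ^ 2) + 1)⁻¹) : ℝ) : ℂ))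
    (d1 := fun ξ => ((1 * (1 - (Real.sqrt (1 + ξ ^ 2) + 1)⁻¹) +
      ξ * ((ξ / Real.sqrt (1 + ξ ^ 2)) * (Real.sqrt (1 + ξ ^ 2) + 1)⁻¹ ^ 2) : ℝ) : ℂ))
    (d2 := fun _ => 0) ?_ ?_ ?_ ?_ ?_ ?_ ?_ n hn f t ht
  · intro ξ
    rw [add_zero]
    have e1 := ((hasDerivAt_jb ξ).add_const 1).inv (hp ξ).ne'
    have e2 := ((hasDerivAt_id ξ).mul (e1.const_sub 1)).ofReal_comp
    refine e2.congr_deriv ?_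
    congr 1
    simp only [id_eq, Pi.inv_apply, div_eq_mul_inv, inv_pow]
    ring
  · have := cont_div_jb
    exact Continuous.aestronglyMeasurable (by fun_prop)
  · intro ξ
    have h1 : |1 - (Real.sqrt (1 + ξ ^ 2) + 1)⁻¹| ≤ 1 := by
      have := hle ξ
      rw [abs_of_pos (inv_pos.2 (hp ξ))] at this
      rw [abs_le]; constructor <;> linarith [inv_pos.2 (hp ξ)]
    rw [Complex.norm_real, Real.norm_eq_abs, abs_mul]
    refine (mul_le_of_le_one_right (abs_nonneg _) h1).trans ?_
    nlinarith [sq_abs ξ, sq_nonneg (|ξ| - 1)]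
  · intro ξ
    have h1 : |1 - (Real.sqrt (1 + ξ ^ 2) + 1)⁻¹| ≤ 1 := by
      have := hle ξ
      rw [abs_of_pos (inv_pos.2 (hp ξ))] at this
      rw [abs_le]; constructor <;> linarith [inv_pos.2 (hp ξ)]
    have h2 : |ξ * ((ξ / Real.sqrt (1 + ξ ^ 2)) * (Real.sqrt (1 + ξ ^ 2) + 1)⁻¹ ^ 2)| ≤ |ξ| := by
      rw [abs_mul, abs_mul, abs_pow]
      apply mul_le_of_le_one_right (abs_nonneg _)
      exact mul_le_one₀ (abs_div_jb_le ξ) (by positivity) (pow_le_one₀ (abs_nonneg _) (hle ξ))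
    rw [Complex.norm_real, Real.norm_eq_abs]
    refine (abs_add_le _ _).trans ?_
    rw [one_mul]
    nlinarith [sq_abs ξ, sq_nonneg (|ξ| - 1)]
  · exact integrable_zero _ _ _
  · simp
  · intro ξ
    rw [← Complex.ofReal_mul]
    congr 1
    have h1 := (jb_pos ξ).ne'
    have h2 := (hp ξ).ne'
    field_simp
    have := jb_sq ξ
    linear_combination Real.sqrt (1 + ξ ^ 2) * this

lemma est_xi_jb (hφc : Continuous φ) (hφ0 : ∀ x, 0 ≤ φ x) (hφ1 : ∀ x, φ x ≤ 1)
    (hφzero : ∀ x : ℝ, 2 ≤ |x| → φ x = 0)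
    (n : ℕ) (hn : 1 ≤ n) (f : SchwartzMap ℝ ℂ) (t : ℝ) (ht : 0 ≤ t) :
    MemLp (fun x => (jbInv x : ℂ) *
      propagatorM (fun ξ => Complex.I * (ξ : ℂ) * ((Real.sqrt (1 + ξ ^ 2) - 1 : ℝ) : ℂ)) t f x) 2 volume ∧
    l2Norm (fun x => (jbInv x : ℂ) *
      propagatorM (fun ξ => Complex.I * (ξ : ℂ) * ((Real.sqrt (1 + ξ ^ 2) - 1 : ℝ) : ℂ)) t f x) ≤
      22 * 2 * (n / Real.sqrt (1 + t ^ 2)) * Bn φ n f := by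
  refine main_est hφc hφ0 hφ1 hφzero
    (b := fun ξ => Complex.I * ((1 + ξ ^ 2 - Real.sqrt (1 + ξ ^ 2) : ℝ) : ℂ))
    (d1 := fun ξ => Complex.I * ((2 * ξ - ξ / Real.sqrt (1 + ξ ^ 2) : ℝ) : ℂ))
    (d2 := fun _ => 0) ?_ ?_ ?_ ?_ ?_ ?_ ?_ n hn f t ht
  · intro ξ
    rw [add_zero]
    have h1 : HasDerivAt (fun ξ : ℝ => 1 + ξ ^ 2) (2 * ξ) ξ := by
      simpa using ((hasDerivAt_id ξ).pow 2).const_add 1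
    exact ((h1.sub (hasDerivAt_jb ξ)).ofReal_comp).const_mul _
  · have := cont_div_jb
    exact Continuous.aestronglyMeasurable (by fun_prop)
  · intro ξ
    rw [norm_mul, Complex.norm_I, one_mul, Complex.norm_real, Real.norm_eq_abs,
      abs_of_nonneg (by linarith [jb_le ξ])]
    linarith [jb_pos ξ, sq_nonneg ξ]
  · intro ξ
    rw [norm_mul, Complex.norm_I, one_mul, Complex.norm_real, Real.norm_eq_abs]
    refine (abs_sub _ _).trans ?_
    rw [abs_mul, abs_two]
    nlinarith [abs_div_jb_le ξ, sq_abs ξ, sq_nonneg (|ξ| - 1)]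
  · exact integrable_zero _ _ _
  · simp
  · intro ξ
    rw [mul_assoc, mul_assoc, ← Complex.ofReal_mul, ← Complex.ofReal_mul]
    congr 2
    have h1 := (jb_pos ξ).ne'
    have := jb_sq ξ
    field_simp
    linear_combination ξ * this

end

/-- Local decay estimates for the linear Klein–Gordon evolution in the adapted
functional framework. -/
theorem local_decay_estimates (φ : ℝ → ℝ) (hφsmooth : ContDiff ℝ (⊤ : ℕ∞) φ)
    (hφeven : ∀ x, φ (-x) = φ x) (hφ0 : ∀ x, 0 ≤ φ x) (hφ1 : ∀ x, φ x ≤ 1)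
    (hφone : ∀ x : ℝ, |x| ≤ 1 → φ x = 1) (hφzero : ∀ x : ℝ, 2 ≤ |x| → φ x = 0) :
    ∃ C : ℝ, 1 ≤ C ∧
      ∀ n : ℕ, 1 ≤ n → ∀ f : SchwartzMap ℝ ℂ, ∀ t : ℝ, 0 ≤ t →
        (h1Norm (fun x => (jbInv x : ℂ) *
              propagatorM (fun ξ => Complex.I * (ξ : ℂ)) t (⇑f) x) +
            h1Norm (fun x => (jbInv x : ℂ) *
              propagatorM (fun ξ => ((Real.sqrt (1 + ξ ^ 2) - 1 : ℝ) : ℂ)) t (⇑f) x) ≤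
          C * ((n : ℝ) / Real.sqrt (1 + t ^ 2)) * Bn φ n (⇑f)) ∧
        (∀ k : ℤ, k ≤ 0 →
          l2Norm (fun x => (jbInv x : ℂ) *
              propagatorM (fun ξ => Complex.I * (ξ : ℂ) * ((φ ((2 : ℝ) ^ (-k) * ξ) : ℝ) : ℂ))
                t (⇑f) x) +
            l2Norm (fun x => (jbInv x : ℂ) *
              propagatorM
                (fun ξ => Complex.I * (ξ : ℂ) * ((1 - φ ((2 : ℝ) ^ (-k) * ξ) : ℝ) : ℂ))
                t (⇑f) x) ≤
          C * ((n : ℝ) / Real.sqrt (1 + t ^ 2)) * Bn φ n (⇑f)) ∧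
        ∀ k : ℤ, k ≤ 0 →
          l2Norm (fun x => (jbInv x : ℂ) *
              propagatorM
                (fun ξ => ((φ ((2 : ℝ) ^ (-k) * ξ) - φ (2 * ((2 : ℝ) ^ (-k) * ξ)) : ℝ) : ℂ))
                t (⇑f) x) +
            l2Norm (fun x => (jbInv x : ℂ) *
              propagatorM (fun ξ => ((1 - φ ((2 : ℝ) ^ (-k) * ξ) : ℝ) : ℂ)) t (⇑f) x) ≤
          C * ((2 : ℝ) ^ |k| * (n : ℝ) / Real.sqrt (1 + t ^ 2)) * Bn φ n (⇑f) := by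
  have hφc : Continuous φ := hφsmooth.continuous
  have hφd : Differentiable ℝ φ := hφsmooth.differentiable (by simp)
  obtain ⟨K, hK1, hK⟩ := deriv_phi_bound hφsmooth hφzero
  have hφabs : ∀ y, |φ y| ≤ 1 := fun y => by rw [abs_of_nonneg (hφ0 y)]; exact hφ1 y
  have hφabs' : ∀ y, |1 - φ y| ≤ 1 := fun y => by
    rw [abs_le]; constructor <;> linarith [hφ0 y, hφ1 y]
  -- the symbol `1 - φ`
  have hcd : Differentiable ℝ (fun y => 1 - φ y) := by fun_prop
  have hcK : ∀ y, |deriv (fun y => 1 - φ y) y| ≤ K * (1 + y ^ 2)⁻¹ := by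
    intro y
    rw [deriv_const_sub, abs_neg]; exact hK y
  -- the symbol `ψ`
  have hψd : Differentiable ℝ (fun y => φ y - φ (2 * y)) := by fun_prop
  have hψ1 : ∀ y, |φ y - φ (2 * y)| ≤ 1 := fun y => by
    rw [abs_le]; constructor <;> linarith [hφ0 y, hφ1 y, hφ0 (2 * y), hφ1 (2 * y)]
  have hψK : ∀ y, |deriv (fun y => φ y - φ (2 * y)) y| ≤ (3 * K) * (1 + y ^ 2)⁻¹ := by
    intro y
    have e1 : HasDerivAt (fun y : ℝ => φ (2 * y)) (deriv φ (2 * y) * 2) y := by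
      have := (hφd (2 * y)).hasDerivAt.comp y ((hasDerivAt_id y).const_mul 2)
      exact HasDerivAt.congr_deriv this (by simp)
    have e2 := ((hφd y).hasDerivAt.sub e1).deriv
    have e3 : deriv (fun y => φ y - φ (2 * y)) y = deriv φ y - deriv φ (2 * y) * 2 := e2
    rw [e3]
    refine (abs_sub _ _).trans ?_
    rw [abs_mul, abs_two]
    have h1 := hK y
    have h2 := hK (2 * y)
    have h3 : (1 + (2 * y) ^ 2)⁻¹ ≤ (1 + y ^ 2)⁻¹ := by
      apply inv_anti₀ (by positivity); nlinarith [sq_nonneg y]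
    have h4 : K * (1 + (2 * y) ^ 2)⁻¹ ≤ K * (1 + y ^ 2)⁻¹ := by gcongr
    linarith
  have hψ0 : ∀ y : ℝ, |y| ≤ 1 / 2 → φ y - φ (2 * y) = 0 := by
    intro y hy
    rw [hφone y (by linarith), hφone (2 * y) (by rw [abs_mul, abs_two]; linarith), sub_self]
  have hc0 : ∀ y : ℝ, |y| ≤ 1 / 2 → 1 - φ y = 0 := by
    intro y hy
    rw [hφone y (by linarith), sub_self]
  obtain ⟨hA1, hA2, hA3⟩ := quotient_bounds hcd hφabs' hc0 hcK
  obtain ⟨hP1, hP2, hP3⟩ := quotient_bounds hψd hψ1 hψ0 hψK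
  refine ⟨2000 * K, by linarith, ?_⟩
  intro n hn f t ht
  have hst := jb_pos t
  have hB0 : 0 ≤ Bn φ n f := by
    obtain ⟨F, hF⟩ := FT_schwartz f
    exact (l2Norm_nonneg _).trans (Bn_bounds hφc hφ0 hφ1 hφzero n hn f F hF).1
  have hX0 : 0 ≤ ((n : ℝ) / Real.sqrt (1 + t ^ 2)) * Bn φ n f := by positivity
  have hXK : ((n : ℝ) / Real.sqrt (1 + t ^ 2)) * Bn φ n f ≤
      K * (((n : ℝ) / Real.sqrt (1 + t ^ 2)) * Bn φ n f) := le_mul_of_one_le_left hX0 hK1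
  refine ⟨?_, ?_, ?_⟩
  · have e1 := scaled_est hφc hφ0 hφ1 hφzero (h := fun _ => 1) (by fun_prop) (K := 1) (by simp)
      (fun y => by simp; positivity) Complex.I one_pos (m := fun ξ : ℝ => Complex.I * (ξ : ℂ))
      (fun ξ => by simp) n hn f t ht
    have e2 := est_xi_sq hφc hφ0 hφ1 hφzero n hn f t ht
    have e3 := est_jb hφc hφ0 hφ1 hφzero n hn f t ht
    have e4 := est_xi_jb hφc hφ0 hφ1 hφzero n hn f t ht
    have i1 := h1_est (m := fun ξ : ℝ => Complex.I * (ξ : ℂ)) (by fun_prop) (fun ξ => by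
      rw [norm_mul, Complex.norm_I, Complex.norm_real, one_mul, Real.norm_eq_abs]
      nlinarith [sq_abs ξ, sq_nonneg (|ξ| - 1)]) (fun ξ => by
      push_cast
      linear_combination (-(ξ : ℂ) ^ 2) * Complex.I_sq) f t _ _ e1 e2
    have i2 := h1_est (m := fun ξ : ℝ => ((Real.sqrt (1 + ξ ^ 2) - 1 : ℝ) : ℂ)) (by fun_prop) (fun ξ => by
      rw [Complex.norm_real, Real.norm_eq_abs]
      refine (jb_sub_one_le ξ).trans ?_
      nlinarith [sq_abs ξ, sq_nonneg (|ξ| - 1)]) (fun ξ => rfl) f t _ _ e3 e4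
    rw [Complex.norm_I] at i1
    calc _ ≤ _ := add_le_add i1 i2
      _ = 352 * (((n : ℝ) / Real.sqrt (1 + t ^ 2)) * Bn φ n f) := by ring
      _ ≤ 2000 * (K * (((n : ℝ) / Real.sqrt (1 + t ^ 2)) * Bn φ n f)) := by linarith
      _ = _ := by ring
  · intro k hk
    have hs : (0:ℝ) < 2 ^ (-k) := by positivity
    have e1 := scaled_est hφc hφ0 hφ1 hφzero (h := φ) hφd (K := K)
      (fun y => (hφabs y).trans hK1) hK Complex.I hs
      (m := fun ξ : ℝ => Complex.I * (ξ : ℂ) * ((φ ((2 : ℝ) ^ (-k) * ξ) : ℝ) : ℂ))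
      (fun ξ => by push_cast; ring) n hn f t ht
    have e2 := scaled_est hφc hφ0 hφ1 hφzero (h := fun y => 1 - φ y) hcd (K := K)
      (fun y => (hφabs' y).trans hK1) hcK Complex.I hs
      (m := fun ξ : ℝ => Complex.I * (ξ : ℂ) * ((1 - φ ((2 : ℝ) ^ (-k) * ξ) : ℝ) : ℂ))
      (fun ξ => by push_cast; ring) n hn f t ht
    have := add_le_add e1.2 e2.2
    rw [Complex.norm_I] at this
    refine this.trans ?_
    calc _ = 176 * (K * (((n : ℝ) / Real.sqrt (1 + t ^ 2)) * Bn φ n f)) := by ring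
      _ ≤ 2000 * (K * (((n : ℝ) / Real.sqrt (1 + t ^ 2)) * Bn φ n f)) := by linarith
      _ = _ := by ring
  · intro k hk
    have hs : (0:ℝ) < 2 ^ (-k) := by positivity
    rw [abs_of_nonpos hk]
    set s : ℝ := 2 ^ (-k) with hsdef
    have hquot : ∀ (q : ℝ → ℝ), (q 0 = 0) → ∀ ξ : ℝ,
        ((q (s * ξ) : ℝ) : ℂ) = (s : ℂ) * ((ξ * (q (s * ξ) / (s * ξ)) : ℝ) : ℂ) := by
      intro q hq ξ
      rw [← Complex.ofReal_mul]
      congr 1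
      rcases eq_or_ne ξ 0 with rfl | h
      · simp [hq]
      · field_simp
    have e1 := scaled_est hφc hφ0 hφ1 hφzero (h := fun y => (φ y - φ (2 * y)) / y) hP1
      hP2 hP3 (s : ℂ) hs
      (m := fun ξ : ℝ => ((φ (s * ξ) - φ (2 * (s * ξ)) : ℝ) : ℂ))
      (hquot (fun y => φ y - φ (2 * y)) (hψ0 0 (by simp))) n hn f t ht
    have e2 := scaled_est hφc hφ0 hφ1 hφzero (h := fun y => (1 - φ y) / y) hA1
      hA2 hA3 (s : ℂ) hs
      (m := fun ξ : ℝ => ((1 - φ (s * ξ) : ℝ) : ℂ))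
      (hquot (fun y => 1 - φ y) (hc0 0 (by simp))) n hn f t ht
    have := add_le_add e1.2 e2.2
    rw [Complex.norm_real, Real.norm_of_nonneg hs.le] at this
    refine this.trans ?_
    have hsX : s * (((n : ℝ) / Real.sqrt (1 + t ^ 2)) * Bn φ n f) ≤
      s * (K * (((n : ℝ) / Real.sqrt (1 + t ^ 2)) * Bn φ n f)) := by gcongr
    have hsX0 : 0 ≤ s * (K * (((n : ℝ) / Real.sqrt (1 + t ^ 2)) * Bn φ n f)) := by positivity
    calc _ = 704 * (s * (K * (((n : ℝ) / Real.sqrt (1 + t ^ 2)) * Bn φ n f))) +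
          880 * (s * (((n : ℝ) / Real.sqrt (1 + t ^ 2)) * Bn φ n f)) := by ring
      _ ≤ 2000 * (s * (K * (((n : ℝ) / Real.sqrt (1 + t ^ 2)) * Bn φ n f))) := by linarith
      _ = _ := by ring
end
end

section
/- Let a > 3/2. There exists a constant C ≥ 1 (depending only on a) such that for every Schwartz function f and every t ∈ ℝ, ‖⟨x⟩^{-a} · ∂ₓ⟨D⟩⁻¹e^{it⟨D⟩}f‖_{L²(ℝ)} ≤ C ⟨t⟩^{-3/2} ‖⟨x⟩^{a} f‖_{L²(ℝ)}, where ∂ₓ⟨D⟩⁻¹e^{it⟨D⟩}f denotes the function whose Fourier transform is iξ⟨ξ⟩⁻¹e^{it⟨ξ⟩}f̂(ξ). -/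
open MeasureTheory

noncomputable section

/-- `(∂ₓ⟨D⟩⁻¹e^{it⟨D⟩}f)(x) = (2π)^{-1/2} ∫ e^{ixξ} iξ⟨ξ⟩⁻¹ e^{it⟨ξ⟩} f̂(ξ) dξ`. -/
def smoothedPropagator (t : ℝ) (f : ℝ → ℂ) (x : ℝ) : ℂ :=
  (Real.sqrt (2 * Real.pi) : ℂ)⁻¹ *
    ∫ ξ : ℝ, Complex.exp (Complex.I * ((x * ξ + t * Real.sqrt (1 + ξ ^ 2) : ℝ) : ℂ)) *
      (Complex.I * (ξ : ℂ) * ((Real.sqrt (1 + ξ ^ 2) : ℝ) : ℂ)⁻¹) * FT f ξ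


def jb (w : ℝ) : ℝ := Real.sqrt (1 + (2 * Real.pi * w) ^ 2)

lemma jb_pos_s15 (w : ℝ) : 0 < jb w := Real.sqrt_pos.2 (by positivity)

lemma tg_aux (r : ℝ) : Function.HasTemperateGrowth (fun w : ℝ => (1 + (2 * Real.pi * w) ^ 2) ^ r) := by
  have h1 := Function.hasTemperateGrowth_one_add_norm_sq_rpow ℝ r
  have h2 : Function.HasTemperateGrowth (fun w : ℝ => 2 * Real.pi * w) := by fun_prop
  have := h1.comp h2
  simpa [Function.comp_def] using! this

lemma tg_jb : Function.HasTemperateGrowth jb := by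
  have := tg_aux (1/2)
  convert! this using 1
  ext w
  rw [jb, Real.sqrt_eq_rpow]

lemma tg_jb_inv : Function.HasTemperateGrowth (fun w => (jb w)⁻¹) := by
  have := tg_aux (-(1/2))
  convert! this using 1
  ext w
  rw [jb, Real.sqrt_eq_rpow, Real.rpow_neg (by positivity)]

lemma tg_exp : Function.HasTemperateGrowth (fun y : ℝ => Complex.exp (Complex.I * y)) := by
  have key : ∀ n : ℕ, iteratedDeriv n (fun y : ℝ => Complex.exp (Complex.I * y)) =
      fun y : ℝ => Complex.I ^ n * Complex.exp (Complex.I * y) := by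
    intro n
    induction n with
    | zero => simp
    | succ n ih =>
      rw [iteratedDeriv_succ, ih]
      ext y
      have h : HasDerivAt (fun y : ℝ => Complex.exp (Complex.I * y))
          (Complex.exp (Complex.I * y) * (Complex.I * 1)) y := by
        have h0 : HasDerivAt (fun y : ℝ => (y:ℂ)) 1 y := Complex.ofRealCLM.hasDerivAt
        exact (h0.const_mul Complex.I).cexp
      rw [(h.const_mul (Complex.I ^ n)).deriv]
      ring
  refine ⟨?_, fun n => ⟨0, 1, fun x => ?_⟩⟩
  · have : ContDiff ℝ (⊤ : ℕ∞) (fun y : ℝ => (y:ℂ)) := Complex.ofRealCLM.contDiff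
    exact (contDiff_const.mul this).cexp
  · rw [norm_iteratedFDeriv_eq_norm_iteratedDeriv, key]
    simp [mul_comm Complex.I, Complex.norm_exp_ofReal_mul_I]

/-- symbol of the half-wave propagator -/
def mE (t : ℝ) (w : ℝ) : ℂ := Complex.exp (Complex.I * (t * jb w : ℝ))

def mT (t : ℝ) (w : ℝ) : ℂ := (Complex.I * (2 * Real.pi * w : ℝ) * ((jb w : ℝ) : ℂ)⁻¹) * mE t w

lemma tg_mE (t : ℝ) : Function.HasTemperateGrowth (mE t) := by
  have h : Function.HasTemperateGrowth (fun w => t * jb w) := by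
    have := tg_jb
    fun_prop
  exact tg_exp.comp h

lemma tg_mT (t : ℝ) : Function.HasTemperateGrowth (mT t) := by
  have h1 := tg_mE t
  have h2 : Function.HasTemperateGrowth (fun w => ((jb w : ℝ) : ℂ)⁻¹) := by
    have := Function.Complex.hasTemperateGrowth_ofReal.comp tg_jb_inv
    simpa [Function.comp_def] using! this
  have h3 : Function.HasTemperateGrowth (fun w : ℝ => ((2 * Real.pi * w : ℝ) : ℂ)) := by
    have : Function.HasTemperateGrowth (fun w : ℝ => 2 * Real.pi * w) := by fun_prop
    exact Function.Complex.hasTemperateGrowth_ofReal.comp this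
  unfold mT
  fun_prop

lemma norm_mE (t w : ℝ) : ‖mE t w‖ = 1 := by
  rw [mE, mul_comm, Complex.norm_exp_ofReal_mul_I]

lemma abs_le_jb_s15 (w : ℝ) : |2 * Real.pi * w| ≤ jb w := by
  rw [jb]
  apply Real.le_sqrt_of_sq_le
  rw [sq_abs]; linarith

lemma norm_mT_le (t w : ℝ) : ‖mT t w‖ ≤ 1 := by
  rw [mT, norm_mul, norm_mE, norm_mul, norm_mul, norm_inv, Complex.norm_I, Complex.norm_real,
    Complex.norm_real, Real.norm_eq_abs, Real.norm_eq_abs, abs_of_pos (jb_pos_s15 w), one_mul, mul_one,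
    ← div_eq_mul_inv, div_le_one (jb_pos_s15 w)]
  exact abs_le_jb_s15 w

/-- multiplier operators on Schwartz functions -/
def Op (m : ℝ → ℂ) (f : SchwartzMap ℝ ℂ) : SchwartzMap ℝ ℂ := SchwartzMap.fourierMultiplierCLM ℂ m f

open FourierTransform in
lemma Op_apply {m : ℝ → ℂ} (hm : m.HasTemperateGrowth) (f : SchwartzMap ℝ ℂ) (x : ℝ) :
    Op m f x = ∫ w : ℝ, Complex.exp (Complex.I * (2 * Real.pi * x * w : ℝ)) * m w * 𝓕 f w := by
  rw [Op, SchwartzMap.fourierMultiplierCLM_apply, SchwartzMap.fourierInv_coe, Real.fourierInv_eq']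
  congr 1
  ext w
  rw [SchwartzMap.smulLeftCLM_apply_apply hm]
  simp only [smul_eq_mul, mul_assoc]
  congr 2
  simp
  ring

open FourierTransform in
lemma fourier_apply_sch (f : SchwartzMap ℝ ℂ) (w : ℝ) :
    𝓕 f w = ∫ x : ℝ, Complex.exp (-(Complex.I * (2 * Real.pi * x * w : ℝ))) * f x := by
  rw [SchwartzMap.fourier_coe, Real.fourier_eq']
  congr 1
  ext v
  simp only [smul_eq_mul]
  congr 2
  simp
  ring

open FourierTransform in
lemma FT_norm (f : SchwartzMap ℝ ℂ) : eLpNorm (⇑(𝓕 f : SchwartzMap ℝ ℂ)) 2 volume = eLpNorm f 2 volume := by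
  have := SchwartzMap.norm_fourier_toL2_eq f
  rw [SchwartzMap.norm_toLp, SchwartzMap.norm_toLp] at this
  exact (ENNReal.toReal_eq_toReal_iff' (SchwartzMap.eLpNorm_lt_top _ _ _).ne (SchwartzMap.eLpNorm_lt_top _ _ _).ne).1 this

open FourierTransform in
lemma Op_norm {m : ℝ → ℂ} (hm : m.HasTemperateGrowth) (h1 : ∀ w, ‖m w‖ ≤ 1) (f : SchwartzMap ℝ ℂ) :
    eLpNorm (Op m f) 2 volume ≤ eLpNorm f 2 volume := by
  rw [← FT_norm f, ← FT_norm (Op m f), Op, SchwartzMap.fourierMultiplierCLM_apply,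
    FourierTransform.fourier_fourierInv_eq]
  apply eLpNorm_mono
  intro x
  rw [SchwartzMap.smulLeftCLM_apply_apply hm, norm_smul]
  exact mul_le_of_le_one_left (norm_nonneg _) (h1 x)


/-- van der Corput, first derivative test for an increasing derivative bounded below. -/
lemma vdc_first (φ dφ ddφ : ℝ → ℝ) (h1 : ∀ x, HasDerivAt φ (dφ x) x)
    (h2 : ∀ x, HasDerivAt dφ (ddφ x) x) (h2c : Continuous ddφ) (h2p : ∀ x, 0 ≤ ddφ x)
    (A B l : ℝ) (hAB : A ≤ B) (hl : 0 < l) (hA : l ≤ dφ A) :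
    ‖∫ x in A..B, Complex.exp (Complex.I * φ x)‖ ≤ 3 / l := by
  have hmono : Monotone dφ := monotone_of_hasDerivAt_nonneg h2 h2p
  have hpos : ∀ x ∈ Set.uIcc A B, l ≤ dφ x := by
    intro x hx
    rw [Set.uIcc_of_le hAB] at hx
    exact hA.trans (hmono hx.1)
  have c1 : Continuous φ := continuous_iff_continuousAt.2 fun x => (h1 x).continuousAt
  have c2 : Continuous dφ := continuous_iff_continuousAt.2 fun x => (h2 x).continuousAt
  have hne : ∀ x ∈ Set.uIcc A B, dφ x ≠ 0 := fun x hx => (hl.trans_le (hpos x hx)).ne'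
  -- the antiderivative
  let G : ℝ → ℂ := fun x => Complex.exp (Complex.I * φ x) * (-Complex.I * ((dφ x)⁻¹ : ℝ))
  let r : ℝ → ℂ := fun x => Complex.exp (Complex.I * φ x) * (-Complex.I * (-(ddφ x) / (dφ x)^2 : ℝ))
  have hG : ∀ x ∈ Set.uIcc A B, HasDerivAt G (Complex.exp (Complex.I * φ x) + r x) x := by
    intro x hx
    have e1 : HasDerivAt (fun x => Complex.exp (Complex.I * φ x))
        (Complex.exp (Complex.I * φ x) * (Complex.I * (dφ x : ℝ))) x :=
      (((h1 x).ofReal_comp).const_mul Complex.I).cexp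
    have e2 := (((h2 x).fun_inv (hne x hx)).ofReal_comp).const_mul (-Complex.I)
    have e3 := e1.mul e2
    convert! e3 using 1
    simp only [r]
    have : (dφ x : ℂ) ≠ 0 := by exact_mod_cast hne x hx
    congr 1
    push_cast
    field_simp
    simp
  have cexp : Continuous fun x => Complex.exp (Complex.I * φ x) := by fun_prop
  have crq : ContinuousOn (fun x => -(ddφ x) / (dφ x)^2) (Set.uIcc A B) :=
    (h2c.neg.continuousOn).div (c2.pow 2).continuousOn (fun x hx => pow_ne_zero 2 (hne x hx))
  have cr : ContinuousOn r (Set.uIcc A B) := by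
    apply cexp.continuousOn.mul
    apply continuousOn_const.mul
    exact Complex.continuous_ofReal.comp_continuousOn crq
  have i1 : IntervalIntegrable (fun x => Complex.exp (Complex.I * φ x)) volume A B :=
    cexp.intervalIntegrable _ _
  have i2 : IntervalIntegrable r volume A B := cr.intervalIntegrable
  have F1 := intervalIntegral.integral_eq_sub_of_hasDerivAt hG (i1.add i2)
  rw [intervalIntegral.integral_add i1 i2] at F1
  have nE : ∀ x, ‖Complex.exp (Complex.I * φ x)‖ = 1 := fun x => by
    rw [mul_comm, Complex.norm_exp_ofReal_mul_I]
  have hGn : ∀ x ∈ Set.uIcc A B, ‖G x‖ ≤ 1 / l := by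
    intro x hx
    simp only [G, norm_mul, nE, norm_neg, Complex.norm_I, Complex.norm_real, one_mul]
    have := hpos x hx
    rw [Real.norm_eq_abs, abs_of_pos (inv_pos.2 (hl.trans_le this)), one_div]
    exact inv_anti₀ hl this
  have F2 : ∫ x in A..B, -(ddφ x) / (dφ x)^2 = (dφ B)⁻¹ - (dφ A)⁻¹ :=
    intervalIntegral.integral_eq_sub_of_hasDerivAt (fun x hx => (h2 x).fun_inv (hne x hx))
      crq.intervalIntegrable
  have F3 : ‖∫ x in A..B, r x‖ ≤ 1 / l := by
    have : ‖∫ x in A..B, r x‖ ≤ ∫ x in A..B, -(-(ddφ x) / (dφ x)^2) := by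
      apply intervalIntegral.norm_integral_le_of_norm_le hAB _ crq.intervalIntegrable.neg
      refine Filter.Eventually.of_forall fun x _ => ?_
      simp only [r, norm_mul, nE, norm_neg, Complex.norm_I, Complex.norm_real, one_mul]
      rw [Real.norm_eq_abs, abs_of_nonpos
        (div_nonpos_of_nonpos_of_nonneg (neg_nonpos.2 (h2p x)) (sq_nonneg _))]
      exact le_rfl
    refine this.trans ?_
    rw [intervalIntegral.integral_neg, F2]
    have a1 : (dφ A)⁻¹ ≤ 1 / l := by
      rw [one_div]; exact inv_anti₀ hl hA
    have a2 : 0 ≤ (dφ B)⁻¹ := inv_nonneg.2 (hl.le.trans (hpos B Set.right_mem_uIcc))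
    linarith
  have : ∫ x in A..B, Complex.exp (Complex.I * φ x) = G B - G A - ∫ x in A..B, r x :=
    eq_sub_of_add_eq F1
  rw [this]
  calc _ ≤ ‖G B - G A‖ + ‖∫ x in A..B, r x‖ := norm_sub_le _ _
    _ ≤ (‖G B‖ + ‖G A‖) + ‖∫ x in A..B, r x‖ := by gcongr; exact norm_sub_le _ _
    _ ≤ (1/l + 1/l) + 1/l := by
      gcongr
      · exact hGn _ Set.right_mem_uIcc
      · exact hGn _ Set.left_mem_uIcc
    _ = 3 / l := by ring

/-- van der Corput for a globally convex phase with strong convexity near the critical point. -/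
lemma vdc_second (φ dφ ddφ : ℝ → ℝ) (h1 : ∀ x, HasDerivAt φ (dφ x) x)
    (h2 : ∀ x, HasDerivAt dφ (ddφ x) x) (h2c : Continuous ddφ) (h2p : ∀ x, 0 ≤ ddφ x)
    (R t k c : ℝ) (hR : 2 ≤ R) (ht : 1 ≤ t) (hk : 0 < k) (hk2 : ∀ x, |x| ≤ 2 → k * t ≤ ddφ x)
    (hc : |c| ≤ 1) (hc0 : dφ c = 0) :
    ‖∫ x in (-R)..R, Complex.exp (Complex.I * φ x)‖ ≤ (2 + 6 / k) / Real.sqrt t := by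
  set δ := 1 / Real.sqrt t with hδ
  have hst : 1 ≤ Real.sqrt t := Real.one_le_sqrt.2 ht
  have hst0 : 0 < Real.sqrt t := by linarith
  have hδ0 : 0 < δ := by positivity
  have hδ1 : δ ≤ 1 := by rw [hδ, div_le_one hst0]; exact hst
  obtain ⟨hc1, hc2⟩ := abs_le.1 hc
  have c1 : Continuous φ := continuous_iff_continuousAt.2 fun x => (h1 x).continuousAt
  have cexp : Continuous fun x => Complex.exp (Complex.I * φ x) := by fun_prop
  have hdiff : ∀ x y, |x| ≤ 2 → |y| ≤ 2 → x ≤ y → k * t * (y - x) ≤ dφ y - dφ x := by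
    intro x y hx hy hxy
    have := (convex_Icc (-2:ℝ) 2).mul_sub_le_image_sub_of_le_deriv (f := dφ) (C := k * t)
      (fun x _ => (h2 x).continuousAt.continuousWithinAt)
      (fun x _ => (h2 x).differentiableAt.differentiableWithinAt)
      (fun z hz => by
        rw [(h2 z).deriv]
        rw [interior_Icc] at hz
        exact hk2 z (abs_le.2 ⟨hz.1.le, hz.2.le⟩))
    exact this x (abs_le.1 hx) y (abs_le.1 hy) hxy
  have hl : k * t * δ = k * Real.sqrt t := by
    rw [hδ]
    have := Real.mul_self_sqrt (show 0 ≤ t by linarith)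
    field_simp
    nlinarith
  have hlp : 0 < k * Real.sqrt t := by positivity
  have P3 : ‖∫ x in (c+δ)..R, Complex.exp (Complex.I * φ x)‖ ≤ 3 / (k * Real.sqrt t) := by
    apply vdc_first φ dφ ddφ h1 h2 h2c h2p _ _ _ (by linarith) hlp
    have := hdiff c (c+δ) (abs_le.2 ⟨by linarith, by linarith⟩) (abs_le.2 ⟨by linarith, by linarith⟩) (by linarith)
    rw [hc0, add_sub_cancel_left, hl] at this
    linarith
  have P1 : ‖∫ x in (-R)..(c-δ), Complex.exp (Complex.I * φ x)‖ ≤ 3 / (k * Real.sqrt t) := by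
    have e : ∫ x in (-R)..(c-δ), Complex.exp (Complex.I * φ x) =
        ∫ x in (-(c-δ))..R, Complex.exp (Complex.I * φ (-x)) := by
      rw [intervalIntegral.integral_comp_neg (fun x => Complex.exp (Complex.I * φ x))]
      simp
    rw [e]
    apply vdc_first (fun x => φ (-x)) (fun x => -dφ (-x)) (fun x => ddφ (-x)) _ _ (by fun_prop)
      (fun x => h2p _) _ _ _ (by linarith) hlp
    · have := hdiff (c-δ) c (abs_le.2 ⟨by linarith, by linarith⟩) (abs_le.2 ⟨by linarith, by linarith⟩) (by linarith)
      rw [hc0, sub_sub_cancel, hl] at this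
      simp only [neg_neg]
      linarith
    · intro x
      have := (h1 (-x)).comp x (hasDerivAt_neg x)
      convert! this using 1
      ring
    · intro x
      have := ((h2 (-x)).comp x (hasDerivAt_neg x)).neg
      convert! this using 1
      ring
  have P2 : ‖∫ x in (c-δ)..(c+δ), Complex.exp (Complex.I * φ x)‖ ≤ 2 * δ := by
    have := intervalIntegral.norm_integral_le_of_norm_le_const (a := c-δ) (b := c+δ) (C := 1)
      (f := fun x => Complex.exp (Complex.I * φ x))
      (fun x _ => by rw [mul_comm, Complex.norm_exp_ofReal_mul_I])
    refine this.trans (le_of_eq ?_)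
    rw [show c + δ - (c-δ) = 2 * δ by ring, abs_of_pos (by positivity)]
    ring
  have ii : ∀ a b, IntervalIntegrable (fun x => Complex.exp (Complex.I * φ x)) volume a b :=
    fun a b => cexp.intervalIntegrable _ _
  rw [← intervalIntegral.integral_add_adjacent_intervals (ii (-R) (c-δ)) (ii (c-δ) R),
    ← intervalIntegral.integral_add_adjacent_intervals (ii (c-δ) (c+δ)) (ii (c+δ) R)]
  calc _ ≤ 3 / (k * Real.sqrt t) + (2 * δ + 3 / (k * Real.sqrt t)) :=
        (norm_add_le _ _).trans (add_le_add P1 ((norm_add_le _ _).trans (add_le_add P2 P3)))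
    _ = _ := by rw [hδ]; field_simp; ring

/-- Uniform kernel bound (positive time). -/
lemma kernel_pos : ∃ C : ℝ, 0 ≤ C ∧ ∀ t z R : ℝ, 1 ≤ t → |z| ≤ t / 2 → 2 ≤ R →
    ‖∫ x in (-R)..R, Complex.exp (Complex.I * (z * x + t * Real.sqrt (1 + x ^ 2) : ℝ))‖
      ≤ C / Real.sqrt t := by
  refine ⟨2 + 6 / (1/25), by norm_num, fun t z R ht hz hR => ?_⟩
  have hq : ∀ x : ℝ, 0 < 1 + x^2 := fun x => by positivity
  have hs : ∀ x : ℝ, 0 < Real.sqrt (1 + x^2) := fun x => Real.sqrt_pos.2 (hq x)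
  have hss : ∀ x : ℝ, Real.sqrt (1 + x^2) * Real.sqrt (1+x^2) = 1 + x^2 :=
    fun x => Real.mul_self_sqrt (hq x).le
  have d0 : ∀ x : ℝ, HasDerivAt (fun x => Real.sqrt (1 + x^2)) (x / Real.sqrt (1+x^2)) x := by
    intro x
    have := ((hasDerivAt_pow 2 x).const_add 1).sqrt (hq x).ne'
    convert! this using 1
    have := hs x
    field_simp
    simp
    ring
  have d1 : ∀ x : ℝ, HasDerivAt (fun x => z * x + t * Real.sqrt (1 + x ^ 2))
      (z + t * (x / Real.sqrt (1+x^2))) x := by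
    intro x
    have := ((hasDerivAt_id x).const_mul z).add ((d0 x).const_mul t)
    simpa using! this
  have d2 : ∀ x : ℝ, HasDerivAt (fun x => z + t * (x / Real.sqrt (1+x^2)))
      (t * (1 / ((1 + x^2) * Real.sqrt (1+x^2)))) x := by
    intro x
    have := (((hasDerivAt_id x).div (d0 x) (hs x).ne').const_mul t).const_add z
    convert! this using 1
    have h1 := hs x
    have h2 := hss x
    have h3 := hq x
    simp only [id]
    congr 1
    rw [pow_two (Real.sqrt _), h2]
    field_simp
    rw [pow_two, h2]
    ring
  have cI : ContinuousOn (fun x => z + t * (x / Real.sqrt (1+x^2))) (Set.Icc (-1) 1) :=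
    fun x _ => (d2 x).continuousAt.continuousWithinAt
  have hz' := abs_le.1 hz
  have s2 : 1 / 2 ≤ 1 / Real.sqrt 2 := by
    apply one_div_le_one_div_of_le (by positivity)
    rw [Real.sqrt_le_left (by norm_num)]; norm_num
  obtain ⟨c, hc, hc0⟩ : ∃ c ∈ Set.Icc (-1:ℝ) 1, z + t * (c / Real.sqrt (1+c^2)) = 0 := by
    have := intermediate_value_Icc (by norm_num : (-1:ℝ) ≤ 1) cI
    apply this
    constructor
    · norm_num
      rw [neg_div]
      nlinarith
    · norm_num
      rw [← one_div]
      nlinarith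
  apply vdc_second _ _ _ d1 d2 _ _ R t (1/25) c hR ht (by norm_num) _ (abs_le.2 hc) hc0
  · have : ∀ x : ℝ, (1+x^2) * Real.sqrt (1+x^2) ≠ 0 := fun x => (mul_pos (hq x) (hs x)).ne'
    fun_prop (disch := assumption)
  · intro x
    have := hq x; have := hs x
    positivity
  · intro x hx
    have h4 : x^2 ≤ 4 := by
      rw [← sq_abs]; nlinarith [abs_nonneg x]
    have h5 : Real.sqrt (1+x^2) ≤ 5 := by
      rw [Real.sqrt_le_left (by norm_num)]; linarith
    rw [mul_comm (1/25) t]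
    apply mul_le_mul_of_nonneg_left _ (by linarith)
    apply one_div_le_one_div_of_le (mul_pos (hq x) (hs x))
    nlinarith [hs x, hq x]

lemma kernel_bound : ∃ C : ℝ, 0 ≤ C ∧ ∀ t z R : ℝ, 1 ≤ |t| → |z| ≤ |t| / 2 → 2 ≤ R →
    ‖∫ x in (-R)..R, Complex.exp (Complex.I * (z * x + t * Real.sqrt (1 + x ^ 2) : ℝ))‖
      ≤ C / Real.sqrt |t| := by
  obtain ⟨C, hC, h⟩ := kernel_pos
  refine ⟨C, hC, fun t z R ht hz hR => ?_⟩
  rcases le_total 0 t with h0 | h0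
  · rw [abs_of_nonneg h0] at *
    exact h t z R ht hz hR
  · rw [abs_of_nonpos h0] at *
    have := h (-t) (-z) R ht (by rwa [abs_neg]) hR
    rw [← Complex.norm_conj, ← intervalIntegral.intervalIntegral_conj] at this
    have e : ∀ x : ℝ, (starRingEnd ℂ) (Complex.exp (Complex.I * (-z * x + -t * Real.sqrt (1 + x ^ 2) : ℝ)))
        = Complex.exp (Complex.I * (z * x + t * Real.sqrt (1 + x ^ 2) : ℝ)) := by
      intro x
      rw [← Complex.exp_conj]
      congr 1
      simp
      ring
    simpa only [e] using this

lemma jb_hasDeriv (w : ℝ) : HasDerivAt jb (2 * Real.pi * ((2 * Real.pi * w) / jb w)) w := by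
  have h0 : 0 < 1 + (2 * Real.pi * w)^2 := by positivity
  have h1 : HasDerivAt (fun w : ℝ => 2 * Real.pi * w) (2 * Real.pi) w := by
    simpa using (hasDerivAt_id w).const_mul (2 * Real.pi)
  have := ((h1.fun_pow 2).const_add 1).sqrt h0.ne'
  convert! this using 1
  have := jb_pos_s15 w
  unfold jb at *
  field_simp
  simp
  ring

lemma mE_hasDeriv (t w : ℝ) : HasDerivAt (mE t) (2 * Real.pi * t * mT t w) w := by
  have h := ((((jb_hasDeriv w).const_mul t).ofReal_comp).const_mul Complex.I).cexp
  convert! h using 1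
  rw [mT, mE]
  push_cast
  ring

lemma mE_cont (t : ℝ) : Continuous (mE t) := (tg_mE t).1.continuous
lemma mT_cont (t : ℝ) : Continuous (mT t) := (tg_mT t).1.continuous

lemma tg_ofReal : Function.HasTemperateGrowth (fun x : ℝ => (x : ℂ)) :=
  Function.Complex.hasTemperateGrowth_ofReal

def mulX (f : SchwartzMap ℝ ℂ) : SchwartzMap ℝ ℂ := SchwartzMap.smulLeftCLM ℂ (fun x : ℝ => (x:ℂ)) f

lemma mulX_apply (f : SchwartzMap ℝ ℂ) (x : ℝ) : mulX f x = x * f x := by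
  rw [mulX, SchwartzMap.smulLeftCLM_apply_apply tg_ofReal, smul_eq_mul]

open FourierTransform in
lemma fourier_hasDeriv (f : SchwartzMap ℝ ℂ) (w : ℝ) :
    HasDerivAt (⇑(𝓕 f : SchwartzMap ℝ ℂ)) (-2 * Real.pi * Complex.I * (𝓕 (mulX f) : SchwartzMap ℝ ℂ) w) w := by
  have h2 : Integrable (fun x : ℝ => x • f x) := by
    have := (mulX f).integrable (μ := volume)
    refine this.congr (Filter.Eventually.of_forall fun x => ?_)
    simp [mulX_apply]
  have h := Real.hasDerivAt_fourier f.integrable h2 w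
  rw [SchwartzMap.fourier_coe]
  convert! h using 1
  rw [SchwartzMap.fourier_coe, Real.fourier_eq', Real.fourier_eq', ← integral_const_mul]
  congr 1
  ext x
  simp only [smul_eq_mul, mulX_apply]
  ring

lemma integrable_aux {m : ℝ → ℂ} (hm : Continuous m) (h1 : ∀ w, ‖m w‖ ≤ 1) (x : ℝ) (g : SchwartzMap ℝ ℂ) :
    Integrable (fun w : ℝ => Complex.exp (Complex.I * (2 * Real.pi * x * w : ℝ)) * m w * g w) := by
  apply (g.integrable (μ := volume)).norm.mono'
  · apply Continuous.aestronglyMeasurable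
    have := g.continuous
    fun_prop
  · refine Filter.Eventually.of_forall fun w => ?_
    rw [norm_mul, norm_mul, mul_comm Complex.I, Complex.norm_exp_ofReal_mul_I, one_mul]
    exact mul_le_of_le_one_left (norm_nonneg _) (h1 w)

open FourierTransform in
lemma kg_commutator (t : ℝ) (f : SchwartzMap ℝ ℂ) (x : ℝ) :
    (t : ℂ) * Op (mT t) f x = Complex.I * Op (mE t) (mulX f) x - Complex.I * (x * Op (mE t) f x) := by
  let e : ℝ → ℂ := fun w => Complex.exp (Complex.I * (2 * Real.pi * x * w : ℝ))
  have he : ∀ w, HasDerivAt e (e w * (Complex.I * (2 * Real.pi * x : ℝ))) w := by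
    intro w
    have h0 : HasDerivAt (fun w : ℝ => 2 * Real.pi * x * w) (2 * Real.pi * x) w := by
      simpa using (hasDerivAt_id w).const_mul (2 * Real.pi * x)
    exact ((h0.ofReal_comp).const_mul Complex.I).cexp
  have hd : ∀ w, HasDerivAt (fun w => e w * mE t w * 𝓕 f w)
      (Complex.I * (2 * Real.pi * x : ℝ) * (e w * mE t w * 𝓕 f w) +
        (2 * Real.pi * t) * (e w * mT t w * 𝓕 f w) +
        (-2 * Real.pi * Complex.I) * (e w * mE t w * 𝓕 (mulX f) w)) w := by
    intro w
    have := ((he w).mul (mE_hasDeriv t w)).mul (fourier_hasDeriv f w)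
    convert! this using 1
    simp only [Pi.mul_apply]
    ring
  have i1 := integrable_aux (mE_cont t) (fun w => (norm_mE t w).le) x (𝓕 f)
  have i2 := integrable_aux (mT_cont t) (fun w => norm_mT_le t w) x (𝓕 f)
  have i3 := integrable_aux (mE_cont t) (fun w => (norm_mE t w).le) x (𝓕 (mulX f))
  have s12 : Integrable (fun w : ℝ => Complex.I * (2 * Real.pi * x : ℝ) *
        (Complex.exp (Complex.I * (2 * Real.pi * x * w : ℝ)) * mE t w * 𝓕 f w) +
      (2 * Real.pi * t) * (Complex.exp (Complex.I * (2 * Real.pi * x * w : ℝ)) * mT t w * 𝓕 f w)) :=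
    (i1.const_mul _).add (i2.const_mul _)
  have hz := integral_eq_zero_of_hasDerivAt_of_integrable hd
    (s12.add (i3.const_mul _)) i1
  simp only [e] at hz
  rw [integral_add s12 (i3.const_mul _),
    integral_add (i1.const_mul _) (i2.const_mul _), integral_const_mul, integral_const_mul,
    integral_const_mul] at hz
  rw [← Op_apply (tg_mE t), ← Op_apply (tg_mT t), ← Op_apply (tg_mE t)] at hz
  have hpi : (2 * Real.pi : ℂ) ≠ 0 := by
    simp [Real.pi_ne_zero]
  apply mul_left_cancel₀ hpi
  push_cast at hz
  linear_combination hz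

open FourierTransform in
lemma near_bound : ∃ C : ℝ, 0 ≤ C ∧ ∀ (t x : ℝ) (g : SchwartzMap ℝ ℂ), 1 ≤ |t| → |x| ≤ |t| / 4 →
    (∀ y, |t| / 4 < |y| → g y = 0) →
    ‖Op (mE t) g x‖ ≤ C / Real.sqrt |t| * ∫ y, ‖g y‖ := by
  obtain ⟨C, hC, hK⟩ := kernel_bound
  refine ⟨C, hC, fun t x g ht hx hg => ?_⟩
  rw [Op_apply (tg_mE t)]
  have i1 := integrable_aux (mE_cont t) (fun w => (norm_mE t w).le) x (𝓕 g)
  have hlim := intervalIntegral_tendsto_integral i1 Filter.tendsto_neg_atTop_atBot Filter.tendsto_id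
  refine le_of_tendsto hlim.norm ?_
  filter_upwards [Filter.eventually_ge_atTop (2:ℝ)] with R hR
  simp only [id]
  let k : ℝ → ℝ → ℂ := fun w y =>
    Complex.exp (Complex.I * ((x - y) * (2 * Real.pi * w) + t * Real.sqrt (1 + (2 * Real.pi * w)^2) : ℝ))
  have e1 : ∫ w in (-R)..R, Complex.exp (Complex.I * (2 * Real.pi * x * w : ℝ)) * mE t w * 𝓕 g w
      = ∫ w in (-R)..R, ∫ y, k w y * g y := by
    congr 1
    ext w
    rw [fourier_apply_sch, ← integral_const_mul]
    congr 1
    ext y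
    rw [← mul_assoc, mE, ← Complex.exp_add, ← Complex.exp_add]
    congr 2
    rw [jb]
    push_cast
    ring
  have kn : ∀ w y, ‖k w y‖ = 1 := fun w y => by
    simp only [k]
    rw [mul_comm, Complex.norm_exp_ofReal_mul_I]
  have hIntg : Integrable (Function.uncurry fun w y => k w y * g y)
      ((volume.restrict (Set.uIoc (-R) R)).prod volume) := by
    have b1 : Integrable (fun _ : ℝ => (1:ℝ)) (volume.restrict (Set.uIoc (-R) R)) := by
      rw [Set.uIoc]
      apply integrable_const
    have b2 := b1.mul_prod (g.integrable (μ := volume)).norm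
    apply b2.mono'
    · apply Continuous.aestronglyMeasurable
      have := g.continuous
      simp only [k, Function.uncurry_def]
      fun_prop
    · refine Filter.Eventually.of_forall fun p => ?_
      simp [Function.uncurry, kn]
  rw [e1, intervalIntegral_integral_swap hIntg, ← integral_const_mul]
  apply norm_integral_le_of_norm_le (g.integrable.norm.const_mul _)
  refine Filter.Eventually.of_forall fun y => ?_
  rw [intervalIntegral.integral_mul_const, norm_mul]
  by_cases hy : |t| / 4 < |y|
  · simp [hg y hy]
  · push Not at hy
    apply mul_le_mul_of_nonneg_right _ (norm_nonneg _)
    have h2pi : 1 ≤ 2 * Real.pi := by linarith [Real.pi_gt_three]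
    have := intervalIntegral.integral_comp_mul_left (a := -R) (b := R) (c := 2 * Real.pi)
      (fun ξ : ℝ => Complex.exp (Complex.I * ((x - y) * ξ + t * Real.sqrt (1 + ξ^2) : ℝ))) (by positivity)
    simp only [k]
    rw [this, norm_smul, mul_neg]
    have hk := hK t (x - y) (2 * Real.pi * R) ht (by
      have := abs_sub x y
      linarith) (by nlinarith)
    refine (mul_le_of_le_one_left (norm_nonneg _) ?_).trans hk
    rw [norm_inv, Real.norm_eq_abs, abs_of_pos (by positivity)]
    exact inv_le_one_of_one_le₀ h2pi

open FourierTransform in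
lemma smoothed_eq (t : ℝ) (f : SchwartzMap ℝ ℂ) (x : ℝ) :
    smoothedPropagator t f x = Op (mT t) f x := by
  have hp : (0:ℝ) < 2 * Real.pi := by positivity
  have hFT : ∀ w : ℝ, FT f (2 * Real.pi * w) = (Real.sqrt (2 * Real.pi) : ℂ)⁻¹ * 𝓕 f w := by
    intro w
    rw [FT, fourier_apply_sch]
    congr 2
    ext y
    congr 2
    push_cast
    ring
  rw [smoothedPropagator, Op_apply (tg_mT t)]
  have := Measure.integral_comp_mul_left (fun ξ : ℝ =>
    Complex.exp (Complex.I * ((x * ξ + t * Real.sqrt (1 + ξ ^ 2) : ℝ) : ℂ)) *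
      (Complex.I * (ξ : ℂ) * ((Real.sqrt (1 + ξ ^ 2) : ℝ) : ℂ)⁻¹) * FT f ξ) (2 * Real.pi)
  rw [abs_of_pos (by positivity), eq_inv_smul_iff₀ hp.ne'] at this
  rw [← this, ← integral_smul, ← integral_const_mul]
  congr 1
  ext w
  rw [hFT w, mT, mE, jb, Complex.real_smul]
  have hs : (Real.sqrt (2 * Real.pi) : ℂ) * (Real.sqrt (2 * Real.pi) : ℂ) = (2 * Real.pi : ℝ) := by
    rw [← Complex.ofReal_mul, Real.mul_self_sqrt hp.le]
  have hs0 : (Real.sqrt (2 * Real.pi) : ℂ) ≠ 0 := by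
    exact_mod_cast (Real.sqrt_pos.2 hp).ne'
  rw [← hs]
  have e1 : Complex.exp (Complex.I * ((x * (2 * Real.pi * w) + t * Real.sqrt (1 + (2 * Real.pi * w) ^ 2) : ℝ) : ℂ))
      = Complex.exp (Complex.I * (2 * Real.pi * x * w : ℝ)) *
        Complex.exp (Complex.I * (t * Real.sqrt (1 + (2 * Real.pi * w) ^ 2) : ℝ)) := by
    rw [← Complex.exp_add]
    congr 1
    push_cast
    ring
  rw [e1]
  field_simp

lemma Op_add (m : ℝ → ℂ) (f g : SchwartzMap ℝ ℂ) : Op m (f + g) = Op m f + Op m g := by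
  simp [Op]

/-- the weight `⟨x⟩^b` -/
def wt (b x : ℝ) : ℝ := (1 + x ^ 2) ^ (b / 2)

lemma wt_pos (b x : ℝ) : 0 < wt b x := Real.rpow_pos_of_pos (by positivity) _

lemma wt_add (b c x : ℝ) : wt (b + c) x = wt b x * wt c x := by
  rw [wt, add_div, Real.rpow_add (by positivity)]; rfl

lemma wt_zero (x : ℝ) : wt 0 x = 1 := by simp [wt]

lemma wt_neg_mul (b x : ℝ) : wt (-b) x * wt b x = 1 := by
  rw [← wt_add, neg_add_cancel, wt_zero]

lemma wt_mono {b c : ℝ} (h : b ≤ c) (x : ℝ) : wt b x ≤ wt c x :=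
  Real.rpow_le_rpow_of_exponent_le (by nlinarith [sq_nonneg x]) (by linarith)

lemma abs_le_wt_one (x : ℝ) : |x| ≤ wt 1 x := by
  rw [wt, ← Real.sqrt_eq_rpow]
  apply Real.le_sqrt_of_sq_le
  rw [sq_abs]; linarith

lemma rpow_le_wt {b : ℝ} (hb : 0 ≤ b) {s x : ℝ} (hs : 0 ≤ s) (h : s ≤ |x|) : s ^ b ≤ wt b x := by
  have : s ^ b = (s ^ 2) ^ (b / 2) := by
    rw [← Real.rpow_natCast, ← Real.rpow_mul hs]
    congr 1
    push_cast
    ring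
  rw [this, wt]
  apply Real.rpow_le_rpow (by positivity) _ (by linarith)
  have : s ^ 2 ≤ |x| ^ 2 := by gcongr
  rw [sq_abs] at this
  linarith

lemma wt_neg_le {b : ℝ} (hb : 0 ≤ b) {s x : ℝ} (hs : 0 < s) (h : s ≤ |x|) : wt (-b) x ≤ (s ^ b)⁻¹ := by
  have h1 := rpow_le_wt hb hs.le h
  have h2 : wt (-b) x = (wt b x)⁻¹ := eq_inv_of_mul_eq_one_left (wt_neg_mul b x)
  rw [h2]
  exact inv_anti₀ (Real.rpow_pos_of_pos hs _) h1

lemma tg_wt (b : ℝ) : Function.HasTemperateGrowth (fun x : ℝ => ((wt b x : ℝ) : ℂ)) := by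
  have h := Function.hasTemperateGrowth_one_add_norm_sq_rpow ℝ (b / 2)
  have := Function.Complex.hasTemperateGrowth_ofReal.comp h
  simpa [Function.comp_def, wt] using! this

def mulW (b : ℝ) (f : SchwartzMap ℝ ℂ) : SchwartzMap ℝ ℂ :=
  SchwartzMap.smulLeftCLM ℂ (fun x : ℝ => ((wt b x : ℝ) : ℂ)) f

lemma mulW_apply (b : ℝ) (f : SchwartzMap ℝ ℂ) (x : ℝ) : mulW b f x = (wt b x : ℂ) * f x := by
  rw [mulW, SchwartzMap.smulLeftCLM_apply_apply (tg_wt b), smul_eq_mul]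

lemma norm_mulW (b : ℝ) (f : SchwartzMap ℝ ℂ) (x : ℝ) : ‖mulW b f x‖ = wt b x * ‖f x‖ := by
  rw [mulW_apply, norm_mul, Complex.norm_real, Real.norm_eq_abs, abs_of_pos (wt_pos b x)]

lemma memLp_wt {b : ℝ} (hb : 1 / 2 < b) : MemLp (wt (-b)) 2 volume := by
  have hc : Continuous (wt (-b)) := by
    have := (Function.hasTemperateGrowth_one_add_norm_sq_rpow ℝ (-b / 2)).1.continuous
    simpa [wt] using! this
  rw [memLp_two_iff_integrable_sq hc.aestronglyMeasurable]
  have := integrable_rpow_neg_one_add_norm_sq (E := ℝ) (μ := volume) (r := 2 * b) (by simp; linarith)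
  refine this.congr (Filter.Eventually.of_forall fun x => ?_)
  simp only [wt, Real.norm_eq_abs, sq_abs]
  rw [← Real.rpow_natCast ((1 + x^2) ^ (-b / 2)) 2, ← Real.rpow_mul (by positivity)]
  congr 1
  push_cast
  ring

lemma eLpNorm_le_of_le (b c : ℝ) (hbc : b ≤ c) (f : SchwartzMap ℝ ℂ) :
    eLpNorm (mulW b f) 2 volume ≤ eLpNorm (mulW c f) 2 volume := by
  apply eLpNorm_mono
  intro x
  rw [norm_mulW, norm_mulW]
  exact mul_le_mul_of_nonneg_right (wt_mono hbc x) (norm_nonneg _)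

lemma eLpNorm_le_mulW (c : ℝ) (hc : 0 ≤ c) (f : SchwartzMap ℝ ℂ) :
    eLpNorm f 2 volume ≤ eLpNorm (mulW c f) 2 volume := by
  apply eLpNorm_mono
  intro x
  rw [norm_mulW]
  have := wt_mono hc x
  rw [wt_zero] at this
  exact le_mul_of_one_le_left (norm_nonneg _) this

lemma L1_bound {b : ℝ} (g : SchwartzMap ℝ ℂ) :
    ENNReal.ofReal (∫ y, ‖g y‖) ≤ eLpNorm (wt (-b)) 2 volume * eLpNorm (mulW b g) 2 volume := by
  rw [ofReal_integral_norm_eq_lintegral_enorm g.integrable, ← eLpNorm_one_eq_lintegral_enorm]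
  have hc : Continuous (wt (-b)) := by
    have := (Function.hasTemperateGrowth_one_add_norm_sq_rpow ℝ (-b / 2)).1.continuous
    simpa [wt] using! this
  have := eLpNorm_smul_le_mul_eLpNorm (p := 2) (q := 2) (r := 1) (μ := volume)
    (f := ⇑(mulW b g)) (φ := wt (-b)) (mulW b g).continuous.aestronglyMeasurable hc.aestronglyMeasurable
  refine le_trans (le_of_eq ?_) this
  congr 1
  ext x
  rw [Pi.smul_apply', mulW_apply, Complex.real_smul, ← mul_assoc, ← Complex.ofReal_mul, wt_neg_mul]
  simp

lemma eLpNorm_three {F : ℝ → ℂ} {u1 u2 u3 : ℝ → ℝ} (h1 : Continuous u1) (h2 : Continuous u2)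
    (h3 : Continuous u3) (h : ∀ x, ‖F x‖ ≤ u1 x + u2 x + u3 x) :
    eLpNorm F 2 volume ≤ eLpNorm u1 2 volume + eLpNorm u2 2 volume + eLpNorm u3 2 volume := by
  have := eLpNorm_mono_real (p := 2) (μ := volume) (f := F) (g := u1 + u2 + u3) h
  refine this.trans ?_
  refine (eLpNorm_add_le (h1.add h2).aestronglyMeasurable h3.aestronglyMeasurable (by norm_num)).trans ?_
  gcongr
  exact eLpNorm_add_le h1.aestronglyMeasurable h2.aestronglyMeasurable (by norm_num)

lemma eLpNorm_cmul {G : ℝ → ℂ} {c : ℝ} :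
    eLpNorm (fun x => c * ‖G x‖) 2 volume ≤ ENNReal.ofReal c.toNNReal * eLpNorm G 2 volume ∨ c < 0 := by
  rcases lt_or_ge c 0 with h | h
  · exact Or.inr h
  · left
    apply eLpNorm_le_mul_eLpNorm_of_ae_le_mul
    refine Filter.Eventually.of_forall fun x => ?_
    rw [norm_mul, norm_norm, Real.norm_eq_abs, abs_of_nonneg h]
    simp [h]

lemma local_decay {b : ℝ} (hb : 1 / 2 < b) : ∃ C : ℝ, 0 ≤ C ∧ ∀ (t : ℝ) (g : SchwartzMap ℝ ℂ), 1 ≤ |t| →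
    eLpNorm (mulW (-b) (Op (mE t) g)) 2 volume ≤
      ENNReal.ofReal (C / Real.sqrt |t|) * eLpNorm (mulW b g) 2 volume := by
  obtain ⟨C, hC, hnear⟩ := near_bound
  have hwm := memLp_wt hb
  set A : ℝ := (eLpNorm (wt (-b)) 2 volume).toReal with hA
  have hA' : eLpNorm (wt (-b)) 2 volume = ENNReal.ofReal A := (ENNReal.ofReal_toReal hwm.2.ne).symm
  have hA0 : 0 ≤ A := ENNReal.toReal_nonneg
  have h8 : (0:ℝ) ≤ 8 ^ b := by positivity
  refine ⟨C * A * A + 8 ^ b + 8 ^ b, by positivity, fun t g ht => ?_⟩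
  have ht0 : 0 < |t| := by linarith
  have hst : 0 < Real.sqrt |t| := Real.sqrt_pos.2 ht0
  let χ : ContDiffBump (0:ℝ) := ⟨|t| / 8, |t| / 4, by positivity, by linarith⟩
  have hχ : Function.HasTemperateGrowth (fun x : ℝ => ((χ x : ℝ) : ℂ)) := by
    have : Function.HasTemperateGrowth (fun x : ℝ => χ x) :=
      χ.hasCompactSupport.hasTemperateGrowth χ.contDiff
    exact Function.Complex.hasTemperateGrowth_ofReal.comp this
  let g1 : SchwartzMap ℝ ℂ := SchwartzMap.smulLeftCLM ℂ (fun x : ℝ => ((χ x : ℝ) : ℂ)) g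
  let g2 : SchwartzMap ℝ ℂ := g - g1
  have g1a : ∀ y, g1 y = (χ y : ℂ) * g y := fun y => by
    simp only [g1]
    rw [SchwartzMap.smulLeftCLM_apply_apply hχ, smul_eq_mul]
  have g2a : ∀ y, g2 y = ((1 - χ y : ℝ) : ℂ) * g y := fun y => by
    simp only [g2, SchwartzMap.sub_apply, g1a]
    push_cast
    ring
  have g1n : ∀ y, ‖g1 y‖ ≤ ‖g y‖ := fun y => by
    rw [g1a, norm_mul, Complex.norm_real, Real.norm_eq_abs, abs_of_nonneg χ.nonneg]
    exact mul_le_of_le_one_left (norm_nonneg _) χ.le_one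
  have g2n : ∀ y, ‖g2 y‖ ≤ ‖g y‖ := fun y => by
    rw [g2a, norm_mul, Complex.norm_real, Real.norm_eq_abs, abs_of_nonneg (by linarith [χ.le_one (x := y)])]
    exact mul_le_of_le_one_left (norm_nonneg _) (by linarith [χ.nonneg (x := y)])
  have g1s : ∀ y, |t| / 4 < |y| → g1 y = 0 := fun y hy => by
    rw [g1a, χ.zero_of_le_dist (by rw [dist_zero_right]; exact hy.le)]
    simp
  have g2s : ∀ y, |y| ≤ |t| / 8 → g2 y = 0 := fun y hy => by
    rw [g2a, χ.one_of_mem_closedBall (by rw [Metric.mem_closedBall, dist_zero_right]; exact hy)]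
    simp
  have hg : g = g1 + g2 := by simp [g2]
  set N := eLpNorm (mulW b g) 2 volume with hN
  have hpow : ∀ s : ℝ, 0 < s → s ≤ 8 → ((|t| / s) ^ b)⁻¹ ≤ 8 ^ b / Real.sqrt |t| := by
    intro s hs0 hs
    rw [Real.div_rpow ht0.le hs0.le, inv_div, Real.sqrt_eq_rpow]
    apply div_le_div₀ h8 (Real.rpow_le_rpow hs0.le hs (by linarith)) (Real.rpow_pos_of_pos ht0 _)
    exact Real.rpow_le_rpow_of_exponent_le ht hb.le
  have wle : ∀ x, wt (-b) x ≤ 1 := fun x => by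
    have := wt_mono (show -b ≤ 0 by linarith) x
    rwa [wt_zero] at this
  have hc : Continuous (wt (-b)) := by
    have := (Function.hasTemperateGrowth_one_add_norm_sq_rpow ℝ (-b / 2)).1.continuous
    simpa [wt] using! this
  have key : eLpNorm (mulW (-b) (Op (mE t) g)) 2 volume ≤
      eLpNorm (fun x => (C / Real.sqrt |t| * ∫ y, ‖g1 y‖) * wt (-b) x) 2 volume +
      eLpNorm (fun x => (8 ^ b / Real.sqrt |t|) * ‖Op (mE t) g1 x‖) 2 volume +
      eLpNorm (fun x => ‖Op (mE t) g2 x‖) 2 volume := by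
    apply eLpNorm_three (by fun_prop) (continuous_const.mul (Op (mE t) g1).continuous.norm)
      (Op (mE t) g2).continuous.norm
    intro x
    simp only [Pi.mul_apply]
    rw [norm_mulW]
    have hw := wt_pos (-b) x
    have hsum : ‖Op (mE t) g x‖ ≤ ‖Op (mE t) g1 x‖ + ‖Op (mE t) g2 x‖ := by
      conv_lhs => rw [hg, Op_add, SchwartzMap.add_apply]
      exact norm_add_le _ _
    have hIntg : 0 ≤ ∫ y, ‖g1 y‖ := integral_nonneg fun y => norm_nonneg _
    have h3 : wt (-b) x * ‖Op (mE t) g2 x‖ ≤ ‖Op (mE t) g2 x‖ :=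
      mul_le_of_le_one_left (norm_nonneg _) (wle x)
    have h4 : wt (-b) x * ‖Op (mE t) g x‖ ≤ wt (-b) x * ‖Op (mE t) g1 x‖ + wt (-b) x * ‖Op (mE t) g2 x‖ := by
      rw [← mul_add]
      exact mul_le_mul_of_nonneg_left hsum hw.le
    have p1 : 0 ≤ (C / Real.sqrt |t| * ∫ y, ‖g1 y‖) * wt (-b) x := by positivity
    have p2 : 0 ≤ (8 ^ b / Real.sqrt |t|) * ‖Op (mE t) g1 x‖ := by positivity
    rcases le_or_gt |x| (|t| / 4) with hx | hx
    · have h5 := mul_le_mul_of_nonneg_right (hnear t x g1 ht hx g1s) hw.le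
      rw [mul_comm (‖Op (mE t) g1 x‖)] at h5
      linarith
    · have h5 : wt (-b) x * ‖Op (mE t) g1 x‖ ≤ (8 ^ b / Real.sqrt |t|) * ‖Op (mE t) g1 x‖ := by
        apply mul_le_mul_of_nonneg_right _ (norm_nonneg _)
        exact (wt_neg_le (by linarith) (by positivity) hx.le).trans (hpow 4 (by norm_num) (by norm_num))
      linarith
  have hIntg1 : ENNReal.ofReal (∫ y, ‖g1 y‖) ≤ ENNReal.ofReal A * N := by
    refine le_trans (ENNReal.ofReal_le_ofReal ?_) (hA' ▸ L1_bound (b := b) g)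
    exact integral_mono g1.integrable.norm g.integrable.norm g1n
  have hIntg : 0 ≤ ∫ y, ‖g1 y‖ := integral_nonneg fun y => norm_nonneg _
  have T1 : eLpNorm (fun x => (C / Real.sqrt |t| * ∫ y, ‖g1 y‖) * wt (-b) x) 2 volume ≤
      ENNReal.ofReal (C * A * A / Real.sqrt |t|) * N := by
    have := eLpNorm_le_mul_eLpNorm_of_ae_le_mul (p := 2) (μ := volume)
      (f := fun x => (C / Real.sqrt |t| * ∫ y, ‖g1 y‖) * wt (-b) x) (g := wt (-b))
      (c := C / Real.sqrt |t| * ∫ y, ‖g1 y‖)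
      (Filter.Eventually.of_forall fun x => by
        rw [norm_mul, Real.norm_eq_abs (C / _ * _), abs_of_nonneg (by positivity)])
    refine this.trans ?_
    rw [hA', ENNReal.ofReal_mul (by positivity)]
    calc _ ≤ ENNReal.ofReal (C / Real.sqrt |t|) * (ENNReal.ofReal A * N) * ENNReal.ofReal A := by gcongr
      _ = ENNReal.ofReal (C / Real.sqrt |t|) * ENNReal.ofReal A * ENNReal.ofReal A * N := by ring
      _ = _ := by
        rw [← ENNReal.ofReal_mul (by positivity), ← ENNReal.ofReal_mul (by positivity)]
        congr 2
        ring
  have T2 : eLpNorm (fun x => (8 ^ b / Real.sqrt |t|) * ‖Op (mE t) g1 x‖) 2 volume ≤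
      ENNReal.ofReal (8 ^ b / Real.sqrt |t|) * N := by
    have := eLpNorm_le_mul_eLpNorm_of_ae_le_mul (p := 2) (μ := volume)
      (f := fun x => (8 ^ b / Real.sqrt |t|) * ‖Op (mE t) g1 x‖) (g := Op (mE t) g1)
      (c := 8 ^ b / Real.sqrt |t|)
      (Filter.Eventually.of_forall fun x => by
        rw [norm_mul, norm_norm, Real.norm_eq_abs, abs_of_nonneg (by positivity)])
    refine this.trans ?_
    gcongr
    refine (Op_norm (tg_mE t) (fun w => (norm_mE t w).le) g1).trans ?_
    exact (eLpNorm_mono g1n).trans (eLpNorm_le_mulW b (by linarith) g)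
  have T3 : eLpNorm (fun x => ‖Op (mE t) g2 x‖) 2 volume ≤
      ENNReal.ofReal (8 ^ b / Real.sqrt |t|) * N := by
    rw [eLpNorm_norm]
    refine (Op_norm (tg_mE t) (fun w => (norm_mE t w).le) g2).trans ?_
    apply eLpNorm_le_mul_eLpNorm_of_ae_le_mul
    refine Filter.Eventually.of_forall fun y => ?_
    rcases le_or_gt |y| (|t| / 8) with hy | hy
    · rw [g2s y hy, norm_zero]; positivity
    · refine (g2n y).trans ?_
      rw [norm_mulW, ← mul_assoc]
      apply le_mul_of_one_le_left (norm_nonneg _)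
      have q1 := hpow 8 (by norm_num) le_rfl
      have q2 := rpow_le_wt (b := b) (by linarith) (by positivity) hy.le
      have q3 : 0 < (|t| / 8) ^ b := by positivity
      calc (1:ℝ) = ((|t| / 8) ^ b)⁻¹ * (|t| / 8) ^ b := (inv_mul_cancel₀ q3.ne').symm
        _ ≤ _ := by gcongr
  refine key.trans ((add_le_add (add_le_add T1 T2) T3).trans (le_of_eq ?_))
  rw [← add_mul, ← add_mul, ← ENNReal.ofReal_add (by positivity) (by positivity),
    ← ENNReal.ofReal_add (by positivity) (by positivity)]
  congr 2
  ring

lemma decay_large {a : ℝ} (ha : 3 / 2 < a) : ∃ C : ℝ, 0 ≤ C ∧ ∀ (t : ℝ) (f : SchwartzMap ℝ ℂ), 1 ≤ |t| →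
    eLpNorm (mulW (-a) (Op (mT t) f)) 2 volume ≤
      ENNReal.ofReal (C / Real.sqrt |t| / |t|) * eLpNorm (mulW a f) 2 volume := by
  obtain ⟨C, hC, hd⟩ := local_decay (b := a - 1) (by linarith)
  refine ⟨C + C, by positivity, fun t f ht => ?_⟩
  have ht0 : 0 < |t| := by linarith
  have hst : 0 < Real.sqrt |t| := Real.sqrt_pos.2 ht0
  have key : eLpNorm (mulW (-a) (Op (mT t) f)) 2 volume ≤
      eLpNorm (fun x => |t|⁻¹ * ‖mulW (-(a-1)) (Op (mE t) (mulX f)) x‖) 2 volume +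
      eLpNorm (fun x => |t|⁻¹ * ‖mulW (-(a-1)) (Op (mE t) f) x‖) 2 volume +
      eLpNorm (fun _ : ℝ => (0:ℝ)) 2 volume := by
    apply eLpNorm_three (continuous_const.mul (SchwartzMap.continuous _).norm)
      (continuous_const.mul (SchwartzMap.continuous _).norm) continuous_const
    intro x
    simp only [Pi.mul_apply]
    have hc := congrArg norm (kg_commutator t f x)
    rw [norm_mul, Complex.norm_real, Real.norm_eq_abs] at hc
    have h1 : |t| * ‖Op (mT t) f x‖ ≤ ‖Op (mE t) (mulX f) x‖ + |x| * ‖Op (mE t) f x‖ := by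
      rw [hc]
      refine (norm_sub_le _ _).trans ?_
      simp
    have hw := wt_pos (-a) x
    have w1 : wt (-a) x ≤ wt (-(a-1)) x := wt_mono (by linarith) x
    have w2 : wt (-a) x * |x| ≤ wt (-(a-1)) x := by
      rw [show -(a-1) = -a + 1 by ring, wt_add]
      exact mul_le_mul_of_nonneg_left (abs_le_wt_one x) hw.le
    rw [norm_mulW, norm_mulW, norm_mulW, add_zero, ← mul_add, ← div_eq_inv_mul, le_div_iff₀ ht0]
    calc wt (-a) x * ‖Op (mT t) f x‖ * |t| = wt (-a) x * (|t| * ‖Op (mT t) f x‖) := by ring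
      _ ≤ wt (-a) x * (‖Op (mE t) (mulX f) x‖ + |x| * ‖Op (mE t) f x‖) := by gcongr
      _ = wt (-a) x * ‖Op (mE t) (mulX f) x‖ + wt (-a) x * |x| * ‖Op (mE t) f x‖ := by ring
      _ ≤ _ := by gcongr
  have sc : ∀ h : SchwartzMap ℝ ℂ, eLpNorm (fun x => |t|⁻¹ * ‖h x‖) 2 volume ≤
      ENNReal.ofReal |t|⁻¹ * eLpNorm h 2 volume := by
    intro h
    apply eLpNorm_le_mul_eLpNorm_of_ae_le_mul
    refine Filter.Eventually.of_forall fun x => ?_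
    rw [norm_mul, norm_norm, Real.norm_eq_abs, abs_of_nonneg (by positivity)]
  have hX : eLpNorm (mulW (a-1) (mulX f)) 2 volume ≤ eLpNorm (mulW a f) 2 volume := by
    apply eLpNorm_mono
    intro x
    rw [norm_mulW, norm_mulW, mulX_apply, norm_mul, Complex.norm_real, Real.norm_eq_abs, ← mul_assoc]
    apply mul_le_mul_of_nonneg_right _ (norm_nonneg _)
    rw [show a = (a-1) + 1 by ring, wt_add, add_sub_cancel_right]
    exact mul_le_mul_of_nonneg_left (abs_le_wt_one x) (wt_pos _ _).le
  have T1 := (sc _).trans (mul_le_mul_right ((hd t (mulX f) ht).trans (mul_le_mul_right hX _)) _)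
  have T2 := (sc _).trans (mul_le_mul_right ((hd t f ht).trans
    (mul_le_mul_right (eLpNorm_le_of_le (a-1) a (by linarith) f) _)) _)
  refine key.trans ((add_le_add (add_le_add T1 T2) (le_of_eq (by simp : _ = (0 : ENNReal)))).trans (le_of_eq ?_))
  rw [add_zero, ← mul_assoc, ← add_mul, ← ENNReal.ofReal_mul (by positivity),
    ← ENNReal.ofReal_add (by positivity) (by positivity)]
  congr 2
  field_simp

lemma decay_small {a : ℝ} (ha : 3 / 2 < a) (t : ℝ) (f : SchwartzMap ℝ ℂ) :
    eLpNorm (mulW (-a) (Op (mT t) f)) 2 volume ≤ eLpNorm (mulW a f) 2 volume := by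
  have h1 : eLpNorm (mulW (-a) (Op (mT t) f)) 2 volume ≤ eLpNorm (Op (mT t) f) 2 volume := by
    apply eLpNorm_mono
    intro x
    rw [norm_mulW]
    have := wt_mono (show -a ≤ 0 by linarith) x
    rw [wt_zero] at this
    exact mul_le_of_le_one_left (norm_nonneg _) this
  exact h1.trans ((Op_norm (tg_mT t) (norm_mT_le t) f).trans (eLpNorm_le_mulW a (by linarith) f))

lemma eLpNorm_two_eq (h : SchwartzMap ℝ ℂ) :
    eLpNorm h 2 volume = ENNReal.ofReal ((∫ x, ‖h x‖ ^ 2) ^ ((1:ℝ) / 2)) := by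
  rw [(h.memLp 2 volume).eLpNorm_eq_integral_rpow_norm (by norm_num) (by norm_num)]
  simp

lemma time_bound {t : ℝ} (ht : 1 ≤ |t|) :
    1 / Real.sqrt |t| / |t| ≤ 2 ^ ((3:ℝ)/4) * (1 + t ^ 2) ^ (-(3:ℝ)/4) := by
  have ht0 : 0 < |t| := by linarith
  have h1 : 1 / Real.sqrt |t| / |t| = (t ^ 2) ^ (-(3:ℝ)/4) := by
    rw [← sq_abs, ← Real.rpow_natCast, ← Real.rpow_mul ht0.le, Real.sqrt_eq_rpow, one_div,
      ← Real.rpow_neg ht0.le, ← Real.rpow_sub_one ht0.ne']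
    congr 1
    push_cast
    ring
  have h2 : (2:ℝ) ^ ((3:ℝ)/4) * (1 + t ^ 2) ^ (-(3:ℝ)/4) = ((1 + t^2) / 2) ^ (-(3:ℝ)/4) := by
    rw [Real.div_rpow (by positivity) (by norm_num), neg_div (4:ℝ) 3, Real.rpow_neg (by norm_num : (0:ℝ) ≤ 2)]
    field_simp
  rw [h1, h2]
  apply Real.rpow_le_rpow_of_nonpos (by positivity)
  · have : 1 ≤ |t| ^ 2 := one_le_pow₀ ht
    rw [sq_abs] at this
    linarith
  · norm_num

lemma time_bound' {t : ℝ} (ht : |t| ≤ 1) :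
    1 ≤ 2 ^ ((3:ℝ)/4) * (1 + t ^ 2) ^ (-(3:ℝ)/4) := by
  have h2 : (2:ℝ) ^ ((3:ℝ)/4) * (1 + t ^ 2) ^ (-(3:ℝ)/4) = ((1 + t^2) / 2) ^ (-(3:ℝ)/4) := by
    rw [Real.div_rpow (by positivity) (by norm_num), neg_div (4:ℝ) 3, Real.rpow_neg (by norm_num : (0:ℝ) ≤ 2)]
    field_simp
  rw [h2]
  apply Real.one_le_rpow_of_pos_of_le_one_of_nonpos (by positivity)
  · have : |t| ^ 2 ≤ 1 := pow_le_one₀ (abs_nonneg _) ht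
    rw [sq_abs] at this
    linarith
  · norm_num

/-- Improved local decay estimate `‖⟨x⟩^{-a} ∂ₓ⟨D⟩⁻¹e^{it⟨D⟩}f‖_{L²} ≲ ⟨t⟩^{-3/2} ‖⟨x⟩^a f‖_{L²}`
for `a > 3/2`. -/
theorem improved_local_decay (a : ℝ) (ha : 3 / 2 < a) :
    ∃ C : ℝ, 1 ≤ C ∧
      ∀ f : SchwartzMap ℝ ℂ, ∀ t : ℝ,
        (∫ x : ℝ, ‖(((1 + x ^ 2) ^ (-a / 2) : ℝ) : ℂ) * smoothedPropagator t (⇑f) x‖ ^ 2) ^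
            ((1 : ℝ) / 2) ≤
          C * (1 + t ^ 2) ^ (-(3 : ℝ) / 4) *
            (∫ x : ℝ, ‖(((1 + x ^ 2) ^ (a / 2) : ℝ) : ℂ) * f x‖ ^ 2) ^ ((1 : ℝ) / 2) := by
  obtain ⟨C, hC, hd⟩ := decay_large ha
  have h2 : (1:ℝ) ≤ 2 ^ ((3:ℝ)/4) := Real.one_le_rpow (by norm_num) (by norm_num)
  refine ⟨(C + 1) * 2 ^ ((3:ℝ)/4), by nlinarith, fun f t => ?_⟩
  have e1 : ∀ x : ℝ, (((1 + x ^ 2) ^ (-a / 2) : ℝ) : ℂ) * smoothedPropagator t (⇑f) x =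
      mulW (-a) (Op (mT t) f) x := fun x => by
    rw [mulW_apply, smoothed_eq]; rfl
  have e2 : ∀ x : ℝ, (((1 + x ^ 2) ^ (a / 2) : ℝ) : ℂ) * f x = mulW a f x := fun x => by
    rw [mulW_apply]; rfl
  simp only [e1, e2]
  have hI : 0 ≤ ∫ x, ‖mulW a f x‖ ^ 2 := integral_nonneg fun x => by positivity
  have hK : 0 ≤ (C + 1) * 2 ^ ((3:ℝ)/4) * (1 + t ^ 2) ^ (-(3 : ℝ) / 4) := by positivity
  rw [← ENNReal.ofReal_le_ofReal_iff (mul_nonneg hK (Real.rpow_nonneg hI _)), ENNReal.ofReal_mul hK,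
    ← eLpNorm_two_eq, ← eLpNorm_two_eq]
  rcases le_total 1 |t| with ht | ht
  · refine (hd t f ht).trans ?_
    gcongr
    have := time_bound ht
    have p : 0 ≤ 1 / Real.sqrt |t| / |t| := by positivity
    calc C / Real.sqrt |t| / |t| = C * (1 / Real.sqrt |t| / |t|) := by ring
      _ ≤ (C + 1) * (2 ^ ((3:ℝ)/4) * (1 + t ^ 2) ^ (-(3:ℝ)/4)) := by
        apply mul_le_mul (by linarith) this p (by linarith)
      _ = _ := by ring
  · refine (decay_small ha t f).trans ?_
    have := time_bound' ht
    apply le_mul_of_one_le_left (zero_le)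
    rw [ENNReal.one_le_ofReal, mul_assoc]
    nlinarith
end
end
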